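/- arXiv:1810.10842 — 5 statements merged into one kernel-verified Lean document; each statement's English description precedes it below -/
import Mathlib

section
/- There exist absolute constants c > 0 and C > 0 such that for every finite set A ⊆ ℝ with |A| ≥ 2 and 0 ∉ A, writing K := |A+A|/|A|, one has |AAAA/AAAA| ≥ c · |A|^(100/49) / (K^(40/7) · (log |A|)^C). -/
open Finset Pointwise

/-- The elements `a` of `S` whose successor in `S` is `a + d`. -/
noncomputable def gapSet (S : Finset ℝ) (d : ℝ) : Finset ℝ :=
  S.filter fun a => a + d ∈ S ∧ ∀ b ∈ S, a < b → a + d ≤ b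

theorem mem_gapSet {S : Finset ℝ} {d a : ℝ} :
    a ∈ gapSet S d ↔ a ∈ S ∧ a + d ∈ S ∧ ∀ b ∈ S, a < b → a + d ≤ b := by
  simp [gapSet]

theorem gapSet_subset (S : Finset ℝ) (d : ℝ) : gapSet S d ⊆ S := filter_subset _ _

/-- A set with small `S + S - S` has few distinct consecutive gaps, up to discarding half of
its elements. -/
theorem exists_few_gaps {S T : Finset ℝ} (hS : 2 ≤ #S) (hT : S + S - S ⊆ T) :
    ∃ D : Finset ℝ, (∀ d ∈ D, 0 < d) ∧ #S - 1 ≤ 2 * ∑ d ∈ D, #(gapSet S d) ∧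
      #D * (#S - 1) ≤ 2 * #T ∧ D.Nonempty := by
  classical
  have hSne : S.Nonempty := card_pos.1 (by omega)
  have hex : ∀ a ∈ S.erase (S.max' hSne), ∃ b ∈ S, a < b ∧ ∀ c ∈ S, a < c → b ≤ c := by
    intro a ha
    have hlt : a < S.max' hSne :=
      lt_of_le_of_ne (le_max' _ _ (mem_of_mem_erase ha)) (ne_of_mem_erase ha)
    have hne : (S.filter (a < ·)).Nonempty := ⟨_, mem_filter.2 ⟨max'_mem _ _, hlt⟩⟩
    have hm := mem_filter.1 (min'_mem _ hne)
    exact ⟨_, hm.1, hm.2, fun c hc hac => min'_le _ _ (mem_filter.2 ⟨hc, hac⟩)⟩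
  choose! nx hnxS hnxlt hnxmin using hex
  set R := S.erase (S.max' hSne)
  have hRcard : #R = #S - 1 := card_erase_of_mem (max'_mem _ _)
  let U : ℝ → Finset ℝ := fun a => T.filter fun x => a < x ∧ x ≤ nx a
  have hU : ∀ {a x}, x ∈ U a ↔ x ∈ T ∧ a < x ∧ x ≤ nx a := by simp [U]
  have hsum : ∑ a ∈ R, #(U a) ≤ #T := by
    rw [← card_biUnion]
    · exact card_le_card (biUnion_subset.2 fun a _ => filter_subset _ _)
    · intro a ha b hb hab
      refine Finset.disjoint_left.2 ?_
      intro x hxa hxb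
      have h1 := hU.1 hxa
      have h2 := hU.1 hxb
      rcases lt_or_gt_of_ne hab with h | h
      · linarith [hnxmin a ha b (mem_of_mem_erase hb) h]
      · linarith [hnxmin b hb a (mem_of_mem_erase ha) h]
  have hTpos : 0 < #T := card_pos.2 ((Nonempty.sub (hSne.add hSne) hSne).mono hT)
  set G := R.filter fun a => #(U a) * (#S - 1) ≤ 2 * #T
  have hsplit : #G + #(R.filter fun a => ¬ #(U a) * (#S - 1) ≤ 2 * #T) = #R :=
    card_filter_add_card_filter_not _
  set Bd := R.filter fun a => ¬ #(U a) * (#S - 1) ≤ 2 * #T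
  have hbad : #Bd * (2 * #T) ≤ #T * (#S - 1) := by
    calc #Bd * (2 * #T) ≤ ∑ a ∈ Bd, #(U a) * (#S - 1) := by
          rw [← smul_eq_mul]
          exact card_nsmul_le_sum _ _ _ fun a ha => (not_le.1 (mem_filter.1 ha).2).le
      _ ≤ ∑ a ∈ R, #(U a) * (#S - 1) := sum_le_sum_of_subset (filter_subset _ _)
      _ = (∑ a ∈ R, #(U a)) * (#S - 1) := (sum_mul ..).symm
      _ ≤ _ := Nat.mul_le_mul_right _ hsum
  have hbad' : 2 * #Bd ≤ #S - 1 := by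
    refine Nat.le_of_mul_le_mul_left ?_ hTpos
    linarith
  have hGcard : #S - 1 ≤ 2 * #G := by omega
  have hGne : G.Nonempty := card_pos.1 (by omega)
  have hGR : G ⊆ R := filter_subset _ _
  let D := G.image fun a => nx a - a
  have hDne : D.Nonempty := hGne.image _
  refine ⟨D, ?_, ?_, ?_, hDne⟩
  · intro d hd
    obtain ⟨a, ha, rfl⟩ := mem_image.1 hd
    linarith [hnxlt a (hGR ha)]
  · refine hGcard.trans (Nat.mul_le_mul_left _ ?_)
    rw [card_eq_sum_card_fiberwise (f := fun a => nx a - a) (t := D)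
      (fun a ha => mem_image_of_mem _ ha)]
    refine sum_le_sum fun d _ => card_le_card fun a ha => ?_
    obtain ⟨haG, rfl⟩ := mem_filter.1 ha
    have haR := hGR haG
    refine mem_gapSet.2 ⟨mem_of_mem_erase haR, ?_, ?_⟩
    · simpa using hnxS a haR
    · simpa using hnxmin a haR
  · obtain ⟨a, haG, had⟩ := mem_image.1 (D.max'_mem hDne)
    refine le_trans (Nat.mul_le_mul_right _ ?_) (mem_filter.1 haG).2
    refine card_le_card_of_injOn (fun d => a + d) (fun d hd => ?_) (fun _ _ _ _ h => by simpa using h)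
    have hle := D.le_max' d hd
    obtain ⟨b, hbG, rfl⟩ := mem_image.1 hd
    have hbR := hGR hbG
    refine hU.2 ⟨hT ?_, ?_, ?_⟩
    · simp only [← add_sub_assoc]
      exact sub_mem_sub (add_mem_add (mem_of_mem_erase (hGR haG)) (hnxS b hbR))
        (mem_of_mem_erase hbR)
    · linarith [hnxlt b hbR]
    · simp only at had ⊢
      linarith

theorem exists_gaps_energy {S T : Finset ℝ} (hS : 2 ≤ #S) (hT : S + S - S ⊆ T) :
    ∃ D : Finset ℝ, (∀ d ∈ D, 0 < d) ∧ (#S : ℝ) ^ 3 ≤ 64 * #T * ∑ d ∈ D, (#(gapSet S d) : ℝ) ^ 2 ∧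
      ∃ d ∈ D, (#S : ℝ) ^ 2 ≤ 16 * #T * #(gapSet S d) := by
  obtain ⟨D, hD, hsum, hcard, hne⟩ := exists_few_gaps hS hT
  have hS' : (2 : ℝ) ≤ #S := by exact_mod_cast hS
  have hsum' : (#S : ℝ) - 1 ≤ 2 * ∑ d ∈ D, (#(gapSet S d) : ℝ) := by
    have : #S ≤ 2 * ∑ d ∈ D, #(gapSet S d) + 1 := by omega
    have : (#S : ℝ) ≤ 2 * ∑ d ∈ D, (#(gapSet S d) : ℝ) + 1 := by exact_mod_cast this
    linarith
  have hcard' : (#D : ℝ) * (#S - 1) ≤ 2 * #T := by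
    have h : ((#D * (#S - 1) : ℕ) : ℝ) ≤ ((2 * #T : ℕ) : ℝ) := by exact_mod_cast hcard
    rwa [Nat.cast_mul, Nat.cast_sub (by omega), Nat.cast_mul, Nat.cast_one, Nat.cast_ofNat] at h
  set s : ℝ := (#S : ℝ)
  set t : ℝ := (#T : ℝ)
  have ht : 0 ≤ t := Nat.cast_nonneg _
  have hDpos : (0 : ℝ) < #D := by exact_mod_cast card_pos.2 hne
  set σ := ∑ d ∈ D, (#(gapSet S d) : ℝ)
  have hσpos : 0 < σ := by linarith
  refine ⟨D, hD, ?_, ?_⟩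
  · have hcs : σ ^ 2 ≤ #D * ∑ d ∈ D, (#(gapSet S d) : ℝ) ^ 2 := sq_sum_le_card_mul_sum_sq
    set E := ∑ d ∈ D, (#(gapSet S d) : ℝ) ^ 2
    have hE : 0 ≤ E := sum_nonneg fun _ _ => sq_nonneg _
    have h1 : (s - 1) ^ 2 ≤ 4 * σ ^ 2 := by nlinarith
    have h2 : (s - 1) ^ 2 * (s - 1) ≤ 4 * (#D * E) * (s - 1) :=
      mul_le_mul_of_nonneg_right (by linarith) (by linarith)
    have h3 : (#D * (s - 1)) * E ≤ 2 * t * E := mul_le_mul_of_nonneg_right hcard' hE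
    have h4 : s ^ 3 ≤ (2 * (s - 1)) ^ 3 := pow_le_pow_left₀ (by linarith) (by linarith) 3
    nlinarith
  · have hpop : ∃ d ∈ D, σ / #D ≤ (#(gapSet S d) : ℝ) := by
      refine exists_le_of_sum_le hne ?_
      rw [sum_const, nsmul_eq_mul, mul_div_cancel₀ _ hDpos.ne']
    obtain ⟨d, hd, h⟩ := hpop
    refine ⟨d, hd, ?_⟩
    rw [div_le_iff₀ hDpos] at h
    set r : ℝ := (#(gapSet S d) : ℝ)
    have hr : 0 ≤ r := Nat.cast_nonneg _
    have h1 : (s - 1) * (s - 1) ≤ 2 * (r * #D) * (s - 1) :=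
      mul_le_mul_of_nonneg_right (by linarith) (by linarith)
    have h2 : (#D * (s - 1)) * r ≤ 2 * t * r := mul_le_mul_of_nonneg_right hcard' hr
    nlinarith

theorem sq_card_le_two_mul_card_le_pairs (Q : Finset ℝ) :
    #Q ^ 2 ≤ 2 * #((Q ×ˢ Q).filter fun p => p.1 ≤ p.2) := by
  have h1 : #((Q ×ˢ Q).filter fun p => p.2 ≤ p.1) ≤ #((Q ×ˢ Q).filter fun p => p.1 ≤ p.2) := by
    refine card_le_card_of_injOn Prod.swap (fun p hp => ?_) Prod.swap_injective.injOn
    simp only [coe_filter, mem_product, Set.mem_ofPred_eq, Prod.fst_swap, Prod.snd_swap] at hp ⊢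
    tauto
  have h2 : Q ×ˢ Q ⊆
      ((Q ×ˢ Q).filter fun p => p.1 ≤ p.2) ∪ ((Q ×ˢ Q).filter fun p => p.2 ≤ p.1) := by
    intro p hp
    rw [mem_union, mem_filter, mem_filter]
    rcases le_total p.1 p.2 with h | h
    · exact Or.inl ⟨hp, h⟩
    · exact Or.inr ⟨hp, h⟩
  have h3 := (card_le_card h2).trans (card_union_le _ _)
  rw [card_product] at h3
  rw [sq]
  omega

/-- Squeezing: translates of increments of a strictly increasing, strictly concave function
fit between consecutive values of that function. -/
theorem sum_sq_gapSet_le {S D W : Finset ℝ} {F : ℝ → ℝ} (hS : ∀ a ∈ S, 0 < a)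
    (hD : ∀ d ∈ D, 0 < d) (hmono : ∀ x y, 0 < x → x < y → F x < F y)
    (hconc : ∀ d x y, 0 < d → 0 < x → x < y → F (y + d) - F y < F (x + d) - F x)
    (hW : ∀ d ∈ D, ∀ a ∈ gapSet S d, ∀ b ∈ gapSet S d,
      F a < F a + F (b + d) - F b → F a + F (b + d) - F b ≤ F (a + d) →
        F a + F (b + d) - F b ∈ W) :
    ∑ d ∈ D, (#(gapSet S d) : ℝ) ^ 2 ≤ 2 * #W := by
  classical
  let P : Finset (Σ _ : ℝ, ℝ × ℝ) :=
    D.sigma fun d => (gapSet S d ×ˢ gapSet S d).filter fun p => p.1 ≤ p.2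
  have hP : ∀ x ∈ P, x.1 ∈ D ∧ x.2.1 ∈ gapSet S x.1 ∧ x.2.2 ∈ gapSet S x.1 ∧ x.2.1 ≤ x.2.2 := by
    intro x hx
    simp only [P, mem_sigma, mem_filter, mem_product] at hx
    tauto
  have hbounds : ∀ x ∈ P, F x.2.1 < F x.2.1 + F (x.2.2 + x.1) - F x.2.2 ∧
      F x.2.1 + F (x.2.2 + x.1) - F x.2.2 ≤ F (x.2.1 + x.1) := by
    intro x hx
    obtain ⟨hd, ha, hb, hab⟩ := hP x hx
    have ha0 := hS _ (gapSet_subset _ _ ha)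
    have hb0 := hS _ (gapSet_subset _ _ hb)
    have hd0 := hD _ hd
    constructor
    · linarith [hmono _ (x.2.2 + x.1) hb0 (by linarith)]
    · rcases hab.eq_or_lt with h | h
      · rw [h]; linarith
      · linarith [hconc _ _ _ hd0 ha0 h]
  have hcard : #P ≤ #W := by
    refine card_le_card_of_injOn (fun x => F x.2.1 + F (x.2.2 + x.1) - F x.2.2) ?_ ?_
    · intro x hx
      obtain ⟨hd, ha, hb, _⟩ := hP x hx
      exact hW _ hd _ ha _ hb (hbounds x hx).1 (hbounds x hx).2
    · have key : ∀ x ∈ P, ∀ y ∈ P, F x.2.1 + F (x.2.2 + x.1) - F x.2.2 =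
          F y.2.1 + F (y.2.2 + y.1) - F y.2.2 → ¬ x.2.1 < y.2.1 := by
        intro x hx y hy hxy hlt
        obtain ⟨hd, ha, hb, _⟩ := hP x hx
        obtain ⟨hd', ha', hb', _⟩ := hP y hy
        have hle := (mem_gapSet.1 ha).2.2 _ (gapSet_subset _ _ ha') hlt
        have hF : F (x.2.1 + x.1) ≤ F y.2.1 := by
          rcases hle.eq_or_lt with h | h
          · rw [h]
          · exact (hmono _ _ (add_pos (hS _ (gapSet_subset _ _ ha)) (hD _ hd)) h).le
        linarith [(hbounds x hx).2, (hbounds y hy).1]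
      intro x hx y hy hxy
      have h1 : x.2.1 = y.2.1 :=
        le_antisymm (not_lt.1 (key y hy x hx hxy.symm)) (not_lt.1 (key x hx y hy hxy))
      obtain ⟨hd, ha, hb, _⟩ := hP x hx
      obtain ⟨hd', ha', hb', _⟩ := hP y hy
      simp only at hxy
      obtain ⟨d, a, b⟩ := x
      obtain ⟨e, a', b'⟩ := y
      simp only at h1 hd ha hb hd' ha' hb' hxy
      subst h1
      have h2 : d = e := by
        have i1 := (mem_gapSet.1 ha).2.2 _ (mem_gapSet.1 ha').2.1 (by linarith [hD _ hd'])
        have i2 := (mem_gapSet.1 ha').2.2 _ (mem_gapSet.1 ha).2.1 (by linarith [hD _ hd])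
        linarith
      subst h2
      have h3 : b = b' := by
        rcases lt_trichotomy b b' with h | h | h
        · linarith [hconc _ _ _ (hD _ hd) (hS _ (gapSet_subset _ _ hb)) h]
        · exact h
        · linarith [hconc _ _ _ (hD _ hd) (hS _ (gapSet_subset _ _ hb')) h]
      rw [h3]
  have hsum : ∑ d ∈ D, #(gapSet S d) ^ 2 ≤ 2 * #P := by
    rw [card_sigma, mul_sum]
    exact sum_le_sum fun d _ => sq_card_le_two_mul_card_le_pairs _
  have : ∑ d ∈ D, #(gapSet S d) ^ 2 ≤ 2 * #W := by omega
  exact_mod_cast this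

theorem log_add_sub_log_lt {d x y : ℝ} (hd : 0 < d) (hx : 0 < x) (hxy : x < y) :
    Real.log (y + d) - Real.log y < Real.log (x + d) - Real.log x := by
  have hy : 0 < y := hx.trans hxy
  rw [← Real.log_div (by positivity) (by positivity), ← Real.log_div (by positivity) (by positivity)]
  refine Real.log_lt_log (by positivity) ?_
  rw [div_lt_div_iff₀ hy hx]
  nlinarith

theorem log_sub_log_add_concave {d e x y : ℝ} (hd : 0 < d) (he : 0 < e) (hx : 0 < x)
    (hxy : x < y) :
    (Real.log (y + e) - Real.log (y + e + d)) - (Real.log y - Real.log (y + d)) <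
      (Real.log (x + e) - Real.log (x + e + d)) - (Real.log x - Real.log (x + d)) := by
  have hy : 0 < y := hx.trans hxy
  have key : ∀ z : ℝ, 0 < z →
      (Real.log (z + e) - Real.log (z + e + d)) - (Real.log z - Real.log (z + d)) =
        Real.log (1 + e * d / (z * (z + e + d))) := by
    intro z hz
    rw [← Real.log_div (by positivity) (by positivity),
      ← Real.log_div (by positivity) (by positivity),
      ← Real.log_div (by positivity) (by positivity)]
    congr 1
    field_simp
    ring
  rw [key x hx, key y hy]
  refine Real.log_lt_log (by positivity) ?_
  gcongr

/-- A positive set with small `S + S - S` has a large `S * S / S`. -/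
theorem card_pow_three_le {S T : Finset ℝ} (hpos : ∀ a ∈ S, 0 < a) (hS : 2 ≤ #S)
    (hT : S + S - S ⊆ T) : (#S : ℝ) ^ 3 ≤ 128 * #T * #(S * S / S) := by
  classical
  obtain ⟨D, hD, h, -⟩ := exists_gaps_energy hS hT
  have h2 := sum_sq_gapSet_le (W := (S * S / S).image Real.log) (F := Real.log) hpos hD
    (fun x y hx hxy => Real.log_lt_log hx hxy)
    (fun d x y hd hx hxy => log_add_sub_log_lt hd hx hxy) (by
      intro d hd a ha b hb _ _
      obtain ⟨hbS, hbS', -⟩ := mem_gapSet.1 hb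
      have haS := gapSet_subset _ _ ha
      refine mem_image.2 ⟨a * (b + d) / b, div_mem_div (mul_mem_mul haS hbS') hbS, ?_⟩
      have := hpos _ haS
      have := hpos _ hbS
      have := hpos _ hbS'
      rw [Real.log_div (by positivity) (by positivity), Real.log_mul (by positivity) (by positivity)])
  have h3 : (#((S * S / S).image Real.log) : ℝ) ≤ #(S * S / S) := by exact_mod_cast card_image_le
  calc (#S : ℝ) ^ 3 ≤ 64 * #T * ∑ d ∈ D, (#(gapSet S d) : ℝ) ^ 2 := h
    _ ≤ 64 * #T * (2 * #(S * S / S)) := by gcongr; linarith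
    _ = _ := by ring

theorem exists_median {Q : Finset ℝ} (hQ : Q.Nonempty) :
    ∃ p ∈ Q, #Q ≤ 2 * #(Q.filter (· ≤ p)) ∧ #Q ≤ 2 * #(Q.filter (p ≤ ·)) := by
  classical
  set M := Q.filter fun p => #Q ≤ 2 * #(Q.filter (p ≤ ·))
  have hMne : M.Nonempty := by
    refine ⟨Q.min' hQ, mem_filter.2 ⟨min'_mem _ _, ?_⟩⟩
    rw [filter_true_of_mem fun x hx => min'_le _ _ hx]
    omega
  obtain ⟨hpQ, hp⟩ := mem_filter.1 (M.max'_mem hMne)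
  refine ⟨_, hpQ, ?_, hp⟩
  set p := M.max' hMne
  by_contra! hlt
  have hsplit : #(Q.filter (· ≤ p)) + #(Q.filter fun a => ¬ a ≤ p) = #Q :=
    card_filter_add_card_filter_not _
  have hne : (Q.filter fun a => ¬ a ≤ p).Nonempty := card_pos.1 (by omega)
  obtain ⟨hrQ, hr⟩ := mem_filter.1 (min'_mem _ hne)
  set r := (Q.filter fun a => ¬ a ≤ p).min' hne
  have hrM : r ∈ M := by
    refine mem_filter.2 ⟨hrQ, ?_⟩
    have : #(Q.filter fun a => ¬ a ≤ p) ≤ #(Q.filter (r ≤ ·)) :=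
      card_le_card fun a ha => mem_filter.2 ⟨(mem_filter.1 ha).1, min'_le _ _ ha⟩
    omega
  exact hr (M.le_max' _ hrM)

/-- Two-fold squeezing inside the gaps of a fixed length `d`. -/
theorem card_gapSet_pow_four_le {S T : Finset ℝ} {d : ℝ} (hpos : ∀ a ∈ S, 0 < a) (hd : 0 < d)
    (hT : S + S - S ⊆ T) (hq : 3 ≤ #(gapSet S d)) :
    (#(gapSet S d) : ℝ) ^ 4 ≤ 2 ^ 11 * #T * #(S * S * S * S / (S * S * S)) := by
  classical
  set Q := gapSet S d
  obtain ⟨p, hpQ, hL, hH⟩ := exists_median (Q := Q) (card_pos.1 (by omega))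
  set L := Q.filter (· ≤ p)
  set H := Q.filter (p ≤ ·)
  have hHS : H ⊆ S := (filter_subset _ _).trans (gapSet_subset _ _)
  have hHpos : ∀ a ∈ H, 0 < a := fun a ha => hpos a (hHS ha)
  have hH2 : 2 ≤ #H := by omega
  obtain ⟨D, hD, hen, -⟩ :=
    exists_gaps_energy hH2 ((sub_subset_sub (add_subset_add hHS hHS) hHS).trans hT)
  let F : ℝ → ℝ := fun x => Real.log x - Real.log (x + d)
  have hFneg : ∀ x, 0 < x → F x < 0 := fun x hx =>
    sub_neg.2 (Real.log_lt_log hx (by linarith))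
  have hFmono : ∀ x y, 0 < x → x < y → F x < F y := by
    intro x y hx hxy
    have := log_add_sub_log_lt hd hx hxy
    simp only [F]
    linarith
  have hpS := gapSet_subset _ _ hpQ
  have hp0 := hpos p hpS
  have hFp : ∀ x, p ≤ x → F p ≤ F x := by
    intro x hx
    rcases hx.eq_or_lt with h | h
    · rw [h]
    · exact (hFmono _ _ hp0 h).le
  set W := (H.image F + H.image F - H.image F).filter fun w => F p < w ∧ w < 0
  have hsq := sum_sq_gapSet_le (W := W) (F := F) hHpos hD hFmono
    (fun e x y he hx hxy => log_sub_log_add_concave hd he hx hxy) (by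
      intro e he a ha b hb h1 h2
      have haH := gapSet_subset _ _ ha
      have haH' := (mem_gapSet.1 ha).2.1
      refine mem_filter.2 ⟨?_, ?_, ?_⟩
      · exact sub_mem_sub (add_mem_add (mem_image_of_mem _ haH)
          (mem_image_of_mem _ (mem_gapSet.1 hb).2.1)) (mem_image_of_mem _ (gapSet_subset _ _ hb))
      · exact (hFp a (mem_filter.1 haH).2).trans_lt h1
      · exact h2.trans_lt (hFneg _ (hHpos _ haH')))
  set Y := S * S * S * S / (S * S * S)
  have hLW : #(L ×ˢ W) ≤ #(Y.image Real.log) := by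
    have hb : ∀ x ∈ L ×ˢ W, x.1 ∈ S ∧ x.1 ∈ Q ∧ Real.log x.1 < Real.log x.1 - x.2 ∧
        Real.log x.1 - x.2 < Real.log (x.1 + d) := by
      intro x hx
      obtain ⟨hxL, hxW⟩ := mem_product.1 hx
      obtain ⟨hxQ, hxp⟩ := mem_filter.1 hxL
      obtain ⟨-, hw1, hw2⟩ := mem_filter.1 hxW
      have hxS := gapSet_subset _ _ hxQ
      refine ⟨hxS, hxQ, by linarith, ?_⟩
      have hle : F x.1 ≤ F p := by
        rcases hxp.eq_or_lt with h | h
        · rw [h]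
        · exact (hFmono _ _ (hpos _ hxS) h).le
      simp only [F] at hle hw1
      linarith
    refine card_le_card_of_injOn (fun x => Real.log x.1 - x.2) ?_ ?_
    · intro x hx
      obtain ⟨hxS, -, -⟩ := hb x hx
      obtain ⟨-, hxW⟩ := mem_product.1 hx
      obtain ⟨w, hw, w3, hw3, hxw⟩ := mem_sub.1 (mem_filter.1 hxW).1
      obtain ⟨w1, hw1, w2, hw2, rfl⟩ := mem_add.1 hw
      obtain ⟨h1, hh1, rfl⟩ := mem_image.1 hw1
      obtain ⟨h2, hh2, rfl⟩ := mem_image.1 hw2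
      obtain ⟨h3, hh3, rfl⟩ := mem_image.1 hw3
      have hS' : ∀ h ∈ H, h ∈ S ∧ h + d ∈ S := fun h hh =>
        ⟨hHS hh, (mem_gapSet.1 (mem_filter.1 hh).1).2.1⟩
      refine mem_coe.2 (mem_image.2 ⟨x.1 * (h1 + d) * (h2 + d) * h3 / (h1 * h2 * (h3 + d)),
        div_mem_div (mul_mem_mul (mul_mem_mul (mul_mem_mul hxS (hS' _ hh1).2) (hS' _ hh2).2)
          (hS' _ hh3).1) (mul_mem_mul (mul_mem_mul (hS' _ hh1).1 (hS' _ hh2).1) (hS' _ hh3).2), ?_⟩)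
      have := hpos _ hxS
      have := hHpos _ hh1
      have := hHpos _ hh2
      have := hHpos _ hh3
      simp only [← hxw, F]
      rw [Real.log_div (by positivity) (by positivity), Real.log_mul (by positivity) (by positivity),
        Real.log_mul (by positivity) (by positivity), Real.log_mul (by positivity) (by positivity),
        Real.log_mul (by positivity) (by positivity), Real.log_mul (by positivity) (by positivity)]
      ring
    · have key : ∀ x ∈ L ×ˢ W, ∀ y ∈ L ×ˢ W,
          Real.log x.1 - x.2 = Real.log y.1 - y.2 → ¬ x.1 < y.1 := by
        intro x hx y hy hxy hlt
        obtain ⟨hxS, hxQ, -, h2⟩ := hb x hx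
        obtain ⟨hyS, -, h3, -⟩ := hb y hy
        have hle := (mem_gapSet.1 hxQ).2.2 _ hyS hlt
        linarith [Real.log_le_log (add_pos (hpos _ hxS) hd) hle]
      intro x hx y hy hxy
      have h1 : x.1 = y.1 :=
        le_antisymm (not_lt.1 (key y hy x hx hxy.symm)) (not_lt.1 (key x hx y hy hxy))
      refine Prod.ext h1 ?_
      simp only [h1] at hxy
      linarith
  have hLW' : (#L : ℝ) * #W ≤ #Y := by
    have := hLW.trans card_image_le
    rw [card_product] at this
    exact_mod_cast this
  have hL' : (#Q : ℝ) ≤ 2 * #L := by exact_mod_cast hL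
  have hH' : (#Q : ℝ) ≤ 2 * #H := by exact_mod_cast hH
  have hHW : (#H : ℝ) ^ 3 ≤ 128 * #T * #W :=
    calc (#H : ℝ) ^ 3 ≤ 64 * #T * ∑ d ∈ D, (#(gapSet H d) : ℝ) ^ 2 := hen
      _ ≤ 64 * #T * (2 * #W) := by gcongr
      _ = _ := by ring
  calc (#Q : ℝ) ^ 4 = #Q * (#Q : ℝ) ^ 3 := by ring
    _ ≤ (2 * #L) * (2 * #H : ℝ) ^ 3 := by gcongr
    _ = 16 * #L * (#H : ℝ) ^ 3 := by ring
    _ ≤ 16 * #L * (128 * #T * #W) := by gcongr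
    _ = 2 ^ 11 * #T * (#L * #W) := by ring
    _ ≤ _ := by gcongr

theorem card_pow_eight_le {S T : Finset ℝ} (hpos : ∀ a ∈ S, 0 < a) (hS : 2 ≤ #S)
    (hT : S + S - S ⊆ T) :
    (#S : ℝ) ^ 8 ≤ 2 ^ 27 * (#T : ℝ) ^ 5 * #(S * S * S * S / (S * S * S)) := by
  obtain ⟨D, hD, -, d, hd, h⟩ := exists_gaps_energy hS hT
  have hSne : S.Nonempty := card_pos.1 (by omega)
  have hTpos : 0 < #T := card_pos.2 ((Nonempty.sub (hSne.add hSne) hSne).mono hT)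
  have hYpos : 0 < #(S * S * S * S / (S * S * S)) :=
    card_pos.2 (((((hSne.mul hSne).mul hSne).mul hSne)).div ((hSne.mul hSne).mul hSne))
  have hT1 : (1 : ℝ) ≤ #T := by exact_mod_cast hTpos
  have hY1 : (1 : ℝ) ≤ #(S * S * S * S / (S * S * S)) := by exact_mod_cast hYpos
  by_cases hq : 3 ≤ #(gapSet S d)
  · calc (#S : ℝ) ^ 8 = ((#S : ℝ) ^ 2) ^ 4 := by ring
      _ ≤ (16 * #T * #(gapSet S d) : ℝ) ^ 4 := by gcongr
      _ = 2 ^ 16 * (#T : ℝ) ^ 4 * (#(gapSet S d) : ℝ) ^ 4 := by ring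
      _ ≤ 2 ^ 16 * (#T : ℝ) ^ 4 * (2 ^ 11 * #T * #(S * S * S * S / (S * S * S))) := by
        gcongr
        exact card_gapSet_pow_four_le hpos (hD d hd) hT hq
      _ = _ := by ring
  · have hq' : (#(gapSet S d) : ℝ) ≤ 2 := by
      have : #(gapSet S d) ≤ 2 := by omega
      exact_mod_cast this
    calc (#S : ℝ) ^ 8 = ((#S : ℝ) ^ 2) ^ 4 := by ring
      _ ≤ (16 * #T * #(gapSet S d) : ℝ) ^ 4 := by gcongr
      _ ≤ (16 * #T * 2 : ℝ) ^ 4 := by gcongr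
      _ = 2 ^ 20 * (#T : ℝ) ^ 4 * 1 := by ring
      _ ≤ 2 ^ 27 * (#T : ℝ) ^ 5 * #(S * S * S * S / (S * S * S)) := by
        gcongr <;> norm_num

/-- The two squeezing bounds for a set at least half of whose elements are positive. -/
theorem card_pow_le_of_half_pos {A : Finset ℝ} (hA : 2 ≤ #A)
    (hhalf : #A ≤ 2 * #(A.filter (0 < ·))) :
    (#A : ℝ) ^ 3 ≤ 2 ^ 10 * #(A + A - A) * #((A * A * A * A) / (A * A * A * A)) ∧
      (#A : ℝ) ^ 8 ≤ 2 ^ 35 * (#(A + A - A) : ℝ) ^ 5 * #((A * A * A * A) / (A * A * A * A)) := by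
  set B := A.filter (0 < ·)
  have hBA : B ⊆ A := filter_subset _ _
  have hBpos : ∀ b ∈ B, 0 < b := fun b hb => (mem_filter.1 hb).2
  obtain ⟨x, hx⟩ : B.Nonempty := card_pos.1 (by omega)
  have hxA := hBA hx
  have hx0 := (hBpos x hx).ne'
  have hTA : B + B - B ⊆ A + A - A := sub_subset_sub (add_subset_add hBA hBA) hBA
  set X := (A * A * A * A) / (A * A * A * A)
  have h4 : x * x * x * x ∈ A * A * A * A :=
    mul_mem_mul (mul_mem_mul (mul_mem_mul hxA hxA) hxA) hxA
  have hTpos : 0 < #(A + A - A) := card_pos.2 ⟨_, sub_mem_sub (add_mem_add hxA hxA) hxA⟩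
  have hXpos : 0 < #X := card_pos.2 ⟨_, div_mem_div h4 h4⟩
  have hT1 : (1 : ℝ) ≤ #(A + A - A) := by exact_mod_cast hTpos
  have hX1 : (1 : ℝ) ≤ #X := by exact_mod_cast hXpos
  have hhalf' : (#A : ℝ) ≤ 2 * #B := by exact_mod_cast hhalf
  by_cases hB2 : 2 ≤ #B
  · have hX3 : #(B * B / B) ≤ #X := by
      refine card_le_card_of_injOn (· / x) (fun y hy => ?_) (fun y _ z _ h => ?_)
      · obtain ⟨u, hu, b, hb, rfl⟩ := mem_div.1 (mem_coe.1 hy)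
        refine mem_coe.2 (mem_div.2 ⟨u * x * x,
          mul_mem_mul (mul_mem_mul (mul_subset_mul hBA hBA hu) hxA) hxA, b * x * x * x,
          mul_mem_mul (mul_mem_mul (mul_mem_mul (hBA hb) hxA) hxA) hxA, ?_⟩)
        have hb0 := (hBpos b hb).ne'
        field_simp
      · exact (div_left_inj' hx0).1 h
    have hX7 : #(B * B * B * B / (B * B * B)) ≤ #X := by
      refine card_le_card_of_injOn (· / x) (fun y hy => ?_) (fun y _ z _ h => ?_)
      · obtain ⟨u, hu, v, hv, rfl⟩ := mem_div.1 (mem_coe.1 hy)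
        have hB4 : B * B * B * B ⊆ A * A * A * A :=
          mul_subset_mul (mul_subset_mul (mul_subset_mul hBA hBA) hBA) hBA
        have hB3 : B * B * B ⊆ A * A * A := mul_subset_mul (mul_subset_mul hBA hBA) hBA
        refine mem_coe.2 (mem_div.2 ⟨u, hB4 hu, v * x, mul_mem_mul (hB3 hv) hxA, ?_⟩)
        simp only [div_div]
      · exact (div_left_inj' hx0).1 h
    have hX3' : (#(B * B / B) : ℝ) ≤ #X := by exact_mod_cast hX3
    have hX7' : (#(B * B * B * B / (B * B * B)) : ℝ) ≤ #X := by exact_mod_cast hX7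
    constructor
    · calc (#A : ℝ) ^ 3 ≤ (2 * #B) ^ 3 := by gcongr
        _ = 8 * (#B : ℝ) ^ 3 := by ring
        _ ≤ 8 * (128 * #(A + A - A) * #(B * B / B)) := by
          gcongr
          exact card_pow_three_le hBpos hB2 hTA
        _ ≤ 8 * (128 * #(A + A - A) * #X) := by gcongr
        _ = _ := by ring
    · calc (#A : ℝ) ^ 8 ≤ (2 * #B) ^ 8 := by gcongr
        _ = 2 ^ 8 * (#B : ℝ) ^ 8 := by ring
        _ ≤ 2 ^ 8 * (2 ^ 27 * (#(A + A - A) : ℝ) ^ 5 * #(B * B * B * B / (B * B * B))) := by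
          gcongr
          exact card_pow_eight_le hBpos hB2 hTA
        _ ≤ 2 ^ 8 * (2 ^ 27 * (#(A + A - A) : ℝ) ^ 5 * #X) := by gcongr
        _ = _ := by ring
  · have hA2 : (#A : ℝ) ≤ 2 := by
      have : #A ≤ 2 := by omega
      exact_mod_cast this
    constructor
    · calc (#A : ℝ) ^ 3 ≤ 2 ^ 3 := by gcongr
        _ ≤ 2 ^ 10 * 1 * 1 := by norm_num
        _ ≤ _ := by gcongr
    · calc (#A : ℝ) ^ 8 ≤ 2 ^ 8 := by gcongr
        _ ≤ 2 ^ 35 * 1 ^ 5 * 1 := by norm_num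
        _ ≤ _ := by gcongr

theorem card_pow_le_of_zero_notMem {A : Finset ℝ} (hA : 2 ≤ #A) (h0 : (0 : ℝ) ∉ A) :
    (#A : ℝ) ^ 3 ≤ 2 ^ 10 * #(A + A - A) * #((A * A * A * A) / (A * A * A * A)) ∧
      (#A : ℝ) ^ 8 ≤ 2 ^ 35 * (#(A + A - A) : ℝ) ^ 5 * #((A * A * A * A) / (A * A * A * A)) := by
  by_cases hhalf : #A ≤ 2 * #(A.filter (0 < ·))
  · exact card_pow_le_of_half_pos hA hhalf
  · have hneg : #A ≤ 2 * #((-A).filter (0 < ·)) := by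
      have h1 : #(A.filter (0 < ·)) + #(A.filter fun a => ¬ 0 < a) = #A :=
        card_filter_add_card_filter_not _
      have h2 : #(A.filter fun a => ¬ 0 < a) ≤ #((-A).filter (0 < ·)) := by
        refine card_le_card_of_injOn (fun a => -a) (fun a ha => ?_) neg_injective.injOn
        obtain ⟨haA, ha⟩ := mem_filter.1 (mem_coe.1 ha)
        have hne : a ≠ 0 := fun h => h0 (h ▸ haA)
        refine mem_coe.2 (mem_filter.2 ⟨neg_mem_neg haA, ?_⟩)
        have := lt_of_le_of_ne (not_lt.1 ha) hne
        linarith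
      omega
    have h := card_pow_le_of_half_pos (A := -A) (by rwa [card_neg]) (by rwa [card_neg])
    have e1 : (-A) + (-A) - (-A) = -(A + A - A) := by
      rw [neg_sub', neg_add]
    have e2 : (-A) * (-A) * (-A) * (-A) = A * A * A * A := by
      simp only [neg_mul, mul_neg, neg_neg]
    rwa [e1, e2, card_neg, card_neg] at h

theorem card_add_sub_le {A : Finset ℝ} (hA : A.Nonempty) :
    (#(A + A - A) : ℝ) ≤ ((#(A + A) : ℝ) / #A) ^ 3 * #A := by
  have h := pluennecke_ruzsa_inequality_nsmul_sub_nsmul_add hA A 2 1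
  rw [two_nsmul, one_nsmul] at h
  have h' := (NNRat.cast_le (K := ℝ)).2 h
  push_cast at h'
  exact h'

theorem stmt_4 :
    ∃ c C : ℝ, 0 < c ∧ 0 < C ∧ ∀ A : Finset ℝ,
      2 ≤ A.card → (0 : ℝ) ∉ A →
      c * (A.card : ℝ) ^ ((100 : ℝ) / 49) /
          ((((A + A).card : ℝ) / (A.card : ℝ)) ^ ((40 : ℝ) / 7) *
            (Real.logb 2 (A.card : ℝ)) ^ C)
        ≤ (((A * A * A * A) / (A * A * A * A)).card : ℝ) := by
  refine ⟨1 / 2 ^ 12, 1, by norm_num, one_pos, fun A hA h0 => ?_⟩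
  have hne : A.Nonempty := card_pos.1 (by omega)
  obtain ⟨h3, h8⟩ := card_pow_le_of_zero_notMem hA h0
  have ht := card_add_sub_le hne
  have hn : (2 : ℝ) ≤ #A := by exact_mod_cast hA
  have hs : (#A : ℝ) ≤ #(A + A) := by exact_mod_cast card_le_card_add_self
  have hK : 1 ≤ (#(A + A) : ℝ) / #A := (one_le_div (by linarith)).2 hs
  have hlog : 1 ≤ Real.logb 2 (#A : ℝ) := by
    rw [Real.le_logb_iff_rpow_le one_lt_two (by linarith)]
    simpa using hn
  set K := (#(A + A) : ℝ) / #A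
  set X : ℝ := (#((A * A * A * A) / (A * A * A * A)) : ℝ)
  set n : ℝ := (#A : ℝ)
  set t : ℝ := (#(A + A - A) : ℝ)
  have hX : 0 ≤ X := Nat.cast_nonneg _
  have ht0 : 0 ≤ t := Nat.cast_nonneg _
  have hn0 : 0 < n := by linarith
  have hK0 : 0 < K := by linarith
  have h2' : n ^ 2 ≤ 2 ^ 10 * K ^ 3 * X := by
    refine le_of_mul_le_mul_right ?_ hn0
    calc n ^ 2 * n = n ^ 3 := by ring
      _ ≤ 2 ^ 10 * t * X := h3
      _ ≤ 2 ^ 10 * (K ^ 3 * n) * X := by gcongr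
      _ = _ := by ring
  have h3' : n ^ 3 ≤ 2 ^ 35 * K ^ 15 * X := by
    refine le_of_mul_le_mul_right ?_ (pow_pos hn0 5)
    calc n ^ 3 * n ^ 5 = n ^ 8 := by ring
      _ ≤ 2 ^ 35 * t ^ 5 * X := h8
      _ ≤ 2 ^ 35 * (K ^ 3 * n) ^ 5 * X := by gcongr
      _ = _ := by ring
  have hmain : n ^ 100 ≤ (2 ^ 12 * X) ^ 49 * K ^ 280 :=
    calc n ^ 100 = (n ^ 2) ^ 47 * (n ^ 3) ^ 2 := by ring
      _ ≤ (2 ^ 10 * K ^ 3 * X) ^ 47 * (2 ^ 35 * K ^ 15 * X) ^ 2 := by gcongr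
      _ = ((2 ^ 10) ^ 47 * (2 ^ 35) ^ 2) * X ^ 49 * K ^ 171 := by ring
      _ ≤ (2 ^ 12) ^ 49 * X ^ 49 * K ^ 280 := by
        gcongr <;> norm_num
      _ = _ := by ring
  have hroot : n ^ ((100 : ℝ) / 49) ≤ 2 ^ 12 * X * K ^ ((40 : ℝ) / 7) := by
    refine le_of_pow_le_pow_left₀ (n := 49) (by norm_num) (by positivity) ?_
    rw [mul_pow, ← Real.rpow_mul_natCast hn0.le, ← Real.rpow_mul_natCast hK0.le]
    have e1 : (100 : ℝ) / 49 * (49 : ℕ) = (100 : ℕ) := by norm_num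
    have e2 : (40 : ℝ) / 7 * (49 : ℕ) = (280 : ℕ) := by norm_num
    rw [e1, e2, Real.rpow_natCast, Real.rpow_natCast]
    exact hmain
  have hKp : 0 < K ^ ((40 : ℝ) / 7) := Real.rpow_pos_of_pos hK0 _
  rw [Real.rpow_one, div_le_iff₀ (by positivity)]
  calc 1 / 2 ^ 12 * n ^ ((100 : ℝ) / 49) ≤ 1 / 2 ^ 12 * (2 ^ 12 * X * K ^ ((40 : ℝ) / 7)) := by
        gcongr
    _ = X * (K ^ ((40 : ℝ) / 7) * 1) := by ring
    _ ≤ _ := by gcongr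
end

section
/- There exists an absolute constant C > 0 such that for every finite set A ⊆ ℝ with |A| ≥ 2, writing K := |A+A|/|A|, one has |AAA| ≥ |A|^(2 + 1/392) / (K^(125/56) · (log |A|)^C). -/
open Finset Pointwise

/-- A finite set coloured with `N` colours has at most `N` more elements than it has
ordered monochromatic pairs of distinct elements. -/
lemma card_le_add_card_monochromatic {α : Type*} [DecidableEq α] (F : Finset α) (c : α → ℕ) (N : ℕ)
    (hc : ∀ a ∈ F, c a < N) :
    #F ≤ N + #{p ∈ F ×ˢ F | p.1 ≠ p.2 ∧ c p.1 = c p.2} := by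
  have h1 : #F = ∑ s ∈ range N, #{a ∈ F | c a = s} :=
    card_eq_sum_card_fiberwise (fun a ha ↦ by simpa using hc a ha)
  have h2 : #{p ∈ F ×ˢ F | p.1 ≠ p.2 ∧ c p.1 = c p.2} =
      ∑ s ∈ range N, #({a ∈ F | c a = s} : Finset α).offDiag := by
    rw [card_eq_sum_card_fiberwise (f := fun p : α × α ↦ c p.1) (t := range N)]
    · refine sum_congr rfl fun s _ ↦ congrArg card ?_
      ext ⟨a, b⟩
      simp only [mem_filter, mem_product, mem_offDiag]
      grind
    · intro p hp
      simp only [coe_filter, mem_product, Set.mem_ofPred_eq] at hp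
      simpa using hc p.1 hp.1.1
  rw [h1, h2]
  calc _ ≤ ∑ s ∈ range N, (1 + #({a ∈ F | c a = s} : Finset α).offDiag) := by
        refine sum_le_sum fun s _ ↦ ?_
        rw [offDiag_card]
        generalize #{a ∈ F | c a = s} = i
        rcases i with _ | _ | i
        · simp
        · simp
        · have : (i + 1 + 1) + (i + 1 + 1) ≤ (i + 1 + 1) * (i + 1 + 1) := by nlinarith
          omega
    _ = _ := by rw [sum_add_distrib]; simp

/-- A finite set of reals can be cut into consecutive blocks of at most `k` elements. -/
lemma exists_monotone_block_index (X : Finset ℝ) {k : ℕ} (hk : 0 < k) :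
    ∃ f : ℝ → ℕ, Monotone f ∧ (∀ x, f x ≤ #X / k) ∧ ∀ j, #{x ∈ X | f x = j} ≤ k := by
  have hmono : Monotone fun x : ℝ ↦ #{y ∈ X | y < x} := fun x x' h ↦
    card_le_card (monotone_filter_right X fun y _ hy ↦ lt_of_lt_of_le hy h)
  refine ⟨fun x ↦ #{y ∈ X | y < x} / k, fun x x' h ↦ Nat.div_le_div_right (hmono h),
    fun x ↦ Nat.div_le_div_right (card_filter_le _ _), fun j ↦ ?_⟩
  have : #(Ico (k * j) (k * j + k)) = k := by simp
  refine le_trans (card_le_card_of_injOn (fun x ↦ #{y ∈ X | y < x}) ?_ ?_) this.le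
  · intro x hx
    simp only [coe_filter, Set.mem_ofPred_eq] at hx
    have h := Nat.div_add_mod #{y ∈ X | y < x} k
    have h' := Nat.mod_lt #{y ∈ X | y < x} hk
    rw [hx.2] at h
    simp only [coe_Ico, Set.mem_Ico]
    omega
  · have key : ∀ x ∈ X, ∀ x', x < x' → #{y ∈ X | y < x} < #{y ∈ X | y < x'} := by
      intro x hx x' h
      refine card_lt_card ⟨monotone_filter_right X fun y _ hy ↦ lt_trans hy h, fun hs ↦ ?_⟩
      have := hs (mem_filter.2 ⟨hx, h⟩)
      simp at this
    intro x hx x' hx' h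
    simp only [coe_filter, Set.mem_ofPred_eq] at hx hx' h
    rcases lt_trichotomy x x' with h' | h' | h'
    · exact absurd h (key x hx.1 x' h').ne
    · exact h'
    · exact absurd h.symm (key x' hx'.1 x h').ne

lemma card_pairs_same_fiber_le (X : Finset ℝ) (f : ℝ → ℕ) (k : ℕ)
    (hf : ∀ j, #{x ∈ X | f x = j} ≤ k) :
    #{p ∈ X ×ˢ X | f p.1 = f p.2} ≤ #X * k := by
  rw [card_filter, sum_product, ← smul_eq_mul]
  refine sum_le_card_nsmul _ _ _ fun x _ ↦ ?_
  rw [← card_filter]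
  simpa [eq_comm] using hf (f x)

/-- Incidences between a Cartesian product and the lines `x = q * (u + y)`, with a free
parameter `k`. -/
lemma card_incidences_le (Q U X Y : Finset ℝ) (hQ : ∀ q ∈ Q, 0 < q) {m k : ℕ} (hk : 0 < k)
    (hX : #X ≤ m) (hY : #Y ≤ m) :
    #{p ∈ (Q ×ˢ U) ×ˢ Y | p.1.1 * (p.1.2 + p.2) ∈ X} ≤
      #Q * #U * (2 * (m / k) + 1) + m ^ 2 * k ^ 2 := by
  obtain ⟨f, hf, hfb, hfk⟩ := exists_monotone_block_index X hk
  obtain ⟨g, hg, hgb, hgk⟩ := exists_monotone_block_index Y hk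
  have hfb' : ∀ x, f x ≤ m / k := fun x ↦ (hfb x).trans (Nat.div_le_div_right hX)
  have hgb' : ∀ x, g x ≤ m / k := fun x ↦ (hgb x).trans (Nat.div_le_div_right hY)
  let F : ℝ × ℝ → Finset ℝ := fun l ↦ {y ∈ Y | l.1 * (l.2 + y) ∈ X}
  let c : ℝ × ℝ → ℝ → ℕ := fun l y ↦ f (l.1 * (l.2 + y)) + g y
  let P : ℝ × ℝ → Finset (ℝ × ℝ) := fun l ↦
    {p ∈ F l ×ˢ F l | p.1 ≠ p.2 ∧ c l p.1 = c l p.2}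
  have hI : #{p ∈ (Q ×ˢ U) ×ˢ Y | p.1.1 * (p.1.2 + p.2) ∈ X} = ∑ l ∈ Q ×ˢ U, #(F l) := by
    simp only [F, card_filter]
    rw [sum_product]
  have hcell : ∀ l ∈ Q ×ˢ U, ∀ y y', c l y = c l y' →
      f (l.1 * (l.2 + y)) = f (l.1 * (l.2 + y')) ∧ g y = g y' := by
    intro l hl y y' h
    have hq : 0 < l.1 := hQ _ (mem_product.1 hl).1
    simp only [c] at h
    rcases le_total y y' with h' | h'
    · have h1 := hg h'
      have h2 : f (l.1 * (l.2 + y)) ≤ f (l.1 * (l.2 + y')) := hf (by gcongr)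
      omega
    · have h1 := hg h'
      have h2 : f (l.1 * (l.2 + y')) ≤ f (l.1 * (l.2 + y)) := hf (by gcongr)
      omega
  have hpairs : ∑ l ∈ Q ×ˢ U, #(P l) ≤ m ^ 2 * k ^ 2 := by
    rw [← card_sigma]
    calc _ ≤ #(({p ∈ X ×ˢ X | f p.1 = f p.2} : Finset (ℝ × ℝ)) ×ˢ
              ({p ∈ Y ×ˢ Y | g p.1 = g p.2} : Finset (ℝ × ℝ))) := by
          refine card_le_card_of_injOn (fun t ↦ ((t.1.1 * (t.1.2 + t.2.1),
            t.1.1 * (t.1.2 + t.2.2)), t.2)) ?_ ?_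
          · rintro ⟨l, p⟩ h
            simp only [coe_sigma, Set.mem_sigma_iff, mem_coe, P, F, mem_filter, mem_product] at h
            have := hcell l (mem_product.2 h.1) _ _ h.2.2.2
            simp only [coe_product, Set.mem_prod, mem_coe, mem_filter, mem_product]
            tauto
          · rintro ⟨⟨q, u⟩, y, y'⟩ h ⟨⟨r, v⟩, z, z'⟩ h' heq
            simp only [coe_sigma, Set.mem_sigma_iff, mem_coe, P, F, mem_filter, mem_product] at h h'
            simp only [Prod.mk.injEq] at heq
            obtain ⟨⟨h1, h2⟩, rfl, rfl⟩ := heq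
            have hne : y - y' ≠ 0 := sub_ne_zero.2 h.2.2.1
            have hqr : q = r := by
              apply mul_right_cancel₀ hne
              linear_combination h1 - h2
            subst hqr
            have hq : q ≠ 0 := (hQ q h.1.1).ne'
            have : u = v := by
              have := mul_left_cancel₀ hq h1
              linarith
            subst this
            rfl
      _ ≤ (#X * k) * (#Y * k) := by
          rw [card_product]
          exact Nat.mul_le_mul (card_pairs_same_fiber_le X f k hfk)
            (card_pairs_same_fiber_le Y g k hgk)
      _ ≤ (m * k) * (m * k) := by gcongr
      _ = _ := by ring
  rw [hI]
  calc ∑ l ∈ Q ×ˢ U, #(F l) ≤ ∑ l ∈ Q ×ˢ U, ((2 * (m / k) + 1) + #(P l)) := by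
        refine sum_le_sum fun l _ ↦ card_le_add_card_monochromatic (F l) (c l) _ fun y _ ↦ ?_
        have h1 := hfb' (l.1 * (l.2 + y))
        have h2 := hgb' y
        simp only [c]
        omega
    _ = #Q * #U * (2 * (m / k) + 1) + ∑ l ∈ Q ×ˢ U, #(P l) := by
        rw [sum_add_distrib, sum_const, card_product, smul_eq_mul]
    _ ≤ _ := by gcongr

/-- A Szemerédi–Trotter bound for a Cartesian product and lines of positive slope. -/
lemma card_incidences_cube_le (Q U X Y : Finset ℝ) (hQ : ∀ q ∈ Q, 0 < q) {m : ℕ}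
    (hX : #X ≤ m) (hY : #Y ≤ m) (hm : #Q * #U ≤ m ^ 4) :
    #{p ∈ (Q ×ˢ U) ×ˢ Y | p.1.1 * (p.1.2 + p.2) ∈ X} ^ 3 ≤ 332 * m ^ 4 * (#Q * #U) ^ 2 := by
  set I := #{p ∈ (Q ×ˢ U) ×ˢ Y | p.1.1 * (p.1.2 + p.2) ∈ X} with hI
  set l := #Q * #U with hl
  have hIm : I ≤ l * m := by
    calc I ≤ #((Q ×ˢ U) ×ˢ Y) := card_filter_le _ _
      _ = l * #Y := by rw [card_product, card_product]
      _ ≤ l * m := by gcongr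
  rcases le_or_gt I (2 * l) with h | h
  · calc I ^ 3 ≤ (2 * l) ^ 3 := by gcongr
      _ = 8 * l * l ^ 2 := by ring
      _ ≤ 8 * m ^ 4 * l ^ 2 := by gcongr
      _ ≤ _ := by gcongr; norm_num
  have hI0 : (0 : ℝ) < I := by exact_mod_cast (by omega : 0 < I)
  have hIm' : (I : ℝ) ≤ l * m := by exact_mod_cast hIm
  have h' : (2 * l : ℝ) < I := by exact_mod_cast h
  have hl0 : (0 : ℝ) ≤ l := by positivity
  have hm0 : (0 : ℝ) ≤ m := by positivity
  set k := ⌈(8 * m * l / I : ℝ)⌉₊ with hkdef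
  have hquot : (1 : ℝ) ≤ m * l / I := by rw [le_div_iff₀ hI0]; linarith
  have hk1 : (8 * m * l / I : ℝ) ≤ k := Nat.le_ceil _
  have hk2 : (k : ℝ) < 8 * m * l / I + 1 := Nat.ceil_lt_add_one (by positivity)
  have hk3 : (k : ℝ) ≤ 9 * (m * l / I) := by
    have : (8 * m * l / I : ℝ) = 8 * (m * l / I) := by ring
    linarith
  have hk0 : (0 : ℝ) < k := by
    have : (8 * m * l / I : ℝ) = 8 * (m * l / I) := by ring
    linarith
  have hk : 0 < k := by exact_mod_cast hk0
  have key := card_incidences_le Q U X Y hQ hk hX hY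
  rw [← hI, ← hl] at key
  have key' : (I : ℝ) ≤ l * (2 * ((m / k : ℕ) : ℝ) + 1) + m ^ 2 * k ^ 2 := by exact_mod_cast key
  have hdiv : ((m / k : ℕ) : ℝ) ≤ m / k := Nat.cast_div_le
  have hmk : (l * (m / k) : ℝ) ≤ I / 8 := by
    rw [← mul_div_assoc, div_le_iff₀ hk0]
    rw [div_le_iff₀ hI0] at hk1
    linarith
  have h4 : (I : ℝ) ≤ 4 * (m ^ 2 * k ^ 2) := by
    have : (l * ((m / k : ℕ) : ℝ) : ℝ) ≤ I / 8 := (by gcongr : _ ≤ (l * (m / k) : ℝ)).trans hmk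
    linarith
  have h5 : (I : ℝ) ≤ 4 * (m ^ 2 * (9 * (m * l / I)) ^ 2) := h4.trans (by gcongr)
  have h6 : (I : ℝ) ^ 3 ≤ 324 * (m : ℝ) ^ 4 * (l : ℝ) ^ 2 := by
    calc (I : ℝ) ^ 3 = (I : ℝ) * (I : ℝ) ^ 2 := by ring
      _ ≤ (4 * (m ^ 2 * (9 * (m * l / I)) ^ 2)) * (I : ℝ) ^ 2 := by gcongr
      _ = 324 * (m : ℝ) ^ 4 * (l : ℝ) ^ 2 := by field_simp; ring
  have h7 : I ^ 3 ≤ 324 * m ^ 4 * l ^ 2 := by exact_mod_cast h6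
  exact h7.trans (by gcongr; norm_num)

/-- Dyadic summation: a weak-type bound controls the `k`-th moment up to a logarithm. -/
lemma sum_pow_le_of_card_superlevel_le {ι : Type*} (s : Finset ι) (f : ι → ℕ) {k N : ℕ}
    (hk : k ≠ 0) {B : ℝ} (hf : ∀ i ∈ s, f i ≤ N)
    (h : ∀ t : ℕ, 0 < t → (#{i ∈ s | t ≤ f i} : ℝ) * (t : ℝ) ^ k ≤ B) :
    ∑ i ∈ s, (f i : ℝ) ^ k ≤ 2 ^ k * (Nat.log 2 N + 1) * B := by
  calc ∑ i ∈ s, (f i : ℝ) ^ k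
      ≤ ∑ i ∈ s, ∑ j ∈ range (Nat.log 2 N + 1),
          if 2 ^ j ≤ f i then (2 : ℝ) ^ k * ((2 ^ j : ℕ) : ℝ) ^ k else 0 := by
        refine sum_le_sum fun i hi ↦ ?_
        have hnonneg : ∀ j ∈ range (Nat.log 2 N + 1),
            (0 : ℝ) ≤ if 2 ^ j ≤ f i then (2 : ℝ) ^ k * ((2 ^ j : ℕ) : ℝ) ^ k else 0 :=
          fun j _ ↦ by split_ifs <;> positivity
        rcases Nat.eq_zero_or_pos (f i) with h0 | h0
        · rw [h0]
          simp [hk]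
        · have hmem : Nat.log 2 (f i) ∈ range (Nat.log 2 N + 1) :=
            mem_range.2 (Nat.lt_succ_of_le (Nat.log_mono_right (hf i hi)))
          refine le_trans ?_ (single_le_sum hnonneg hmem)
          rw [if_pos (Nat.pow_log_le_self 2 h0.ne'), ← mul_pow]
          have := (Nat.lt_pow_succ_log_self (b := 2) (by norm_num) (f i)).le
          gcongr
          rw [Nat.succ_eq_add_one, pow_succ'] at this
          exact_mod_cast this
    _ = ∑ j ∈ range (Nat.log 2 N + 1),
          2 ^ k * ((#{i ∈ s | 2 ^ j ≤ f i} : ℝ) * ((2 ^ j : ℕ) : ℝ) ^ k) := by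
        rw [sum_comm]
        refine sum_congr rfl fun j _ ↦ ?_
        rw [← sum_filter, sum_const, nsmul_eq_mul]
        ring
    _ ≤ ∑ _j ∈ range (Nat.log 2 N + 1), 2 ^ k * B := by
        gcongr with j _
        exact h _ (by positivity)
    _ = _ := by
        rw [sum_const, card_range, nsmul_eq_mul]
        push_cast
        ring

lemma card_sq_le_card_mul_card_collisions {α β : Type*} [DecidableEq α] [DecidableEq β]
    (s : Finset α) (t : Finset β) (f : α → β) (hf : ∀ a ∈ s, f a ∈ t) :
    #s ^ 2 ≤ #t * #{p ∈ s ×ˢ s | f p.1 = f p.2} := by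
  have h1 : #s = ∑ b ∈ t, #{a ∈ s | f a = b} := card_eq_sum_card_fiberwise hf
  have h2 : #{p ∈ s ×ˢ s | f p.1 = f p.2} = ∑ b ∈ t, #{a ∈ s | f a = b} ^ 2 := by
    rw [card_eq_sum_card_fiberwise (f := fun p : α × α ↦ f p.1) (t := t)]
    · refine sum_congr rfl fun b _ ↦ ?_
      rw [sq, ← card_product]
      refine congrArg card ?_
      ext ⟨x, y⟩
      simp only [mem_filter, mem_product]
      grind
    · intro p hp
      simp only [coe_filter, mem_product, Set.mem_ofPred_eq] at hp
      exact hf p.1 hp.1.1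
  rw [h2]
  calc #s ^ 2 = (∑ b ∈ t, #{a ∈ s | f a = b}) ^ 2 := by rw [← h1]
    _ ≤ _ := sq_sum_le_card_mul_sum_sq

/-- The third additive energy of `V` is nearly minimal when `V` is nearly invariant under
multiplication by a set `Q` of size comparable with `V`. -/
lemma sum_card_translates_cube_le (Q V : Finset ℝ) (hQ : ∀ q ∈ Q, 0 < q) (hQ0 : Q.Nonempty)
    (hQV : #Q ≤ #(Q * V)) :
    ∑ x ∈ V - V, (#{v ∈ V | x + v ∈ V} : ℝ) ^ 3 ≤
      8 * (Nat.log 2 #V + 1) * (332 * (#(Q * V) : ℝ) ^ 4 / #Q) := by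
  have h8 : (8 : ℝ) = 2 ^ 3 := by norm_num
  rw [h8]
  refine sum_pow_le_of_card_superlevel_le _ _ (by norm_num) (fun x _ ↦ card_filter_le _ _) ?_
  intro t ht
  set U : Finset ℝ := {x ∈ V - V | t ≤ #{v ∈ V | x + v ∈ V}} with hU
  set m := #(Q * V)
  have hVm : #V ≤ m := by
    obtain ⟨q, hq⟩ := hQ0
    exact card_le_card_mul_left_of_injective hq (mul_right_injective₀ (hQ q hq).ne')
  have hUV : #U ≤ m * m := by
    calc #U ≤ #(V - V) := card_filter_le _ _
      _ ≤ #V * #V := card_sub_le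
      _ ≤ m * m := by gcongr
  have hQc : 0 < #Q := hQ0.card_pos
  have hQU : #Q * #U ≤ m ^ 4 := by
    calc #Q * #U ≤ m * (m * m) := by gcongr
      _ = m ^ 3 := by ring
      _ ≤ m ^ 4 := Nat.pow_le_pow_right (by omega) (by norm_num)
  have key := card_incidences_cube_le Q U (Q * V) V hQ le_rfl hVm hQU
  have hlow : #Q * #U * t ≤ #{p ∈ (Q ×ˢ U) ×ˢ V | p.1.1 * (p.1.2 + p.2) ∈ Q * V} := by
    rw [card_filter (fun p : (ℝ × ℝ) × ℝ ↦ _), sum_product, ← card_product, ← smul_eq_mul]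
    refine card_nsmul_le_sum _ _ _ fun l hl ↦ ?_
    rw [← card_filter]
    obtain ⟨hq, hu⟩ := mem_product.1 hl
    refine (mem_filter.1 hu).2.trans (card_le_card (monotone_filter_right V fun v _ hv ↦ ?_))
    exact mul_mem_mul hq hv
  have h1 : (#Q * #U * t) ^ 3 ≤ 332 * m ^ 4 * (#Q * #U) ^ 2 :=
    (Nat.pow_le_pow_left hlow 3).trans key
  rcases Nat.eq_zero_or_pos #U with h0 | h0
  · rw [h0]
    simp only [Nat.cast_zero, zero_mul]
    positivity
  have h2 : #U * t ^ 3 * #Q ≤ 332 * m ^ 4 := by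
    refine Nat.le_of_mul_le_mul_right ?_ (by positivity : 0 < (#Q * #U) ^ 2)
    calc _ = (#Q * #U * t) ^ 3 := by ring
      _ ≤ _ := h1
  rw [le_div_iff₀ (by exact_mod_cast hQc)]
  exact_mod_cast h2

lemma card_sum_pairs_cube_le (Q S : Finset ℝ) (hQ : ∀ q ∈ Q, 0 < q) (hQ0 : Q.Nonempty)
    (hQS : #Q ≤ #(Q * S)) :
    #{p ∈ S ×ˢ S | p.1 + p.2 ∈ S} ^ 3 * #Q ≤ 332 * #(Q * S) ^ 4 * #S ^ 2 := by
  set m := #(Q * S)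
  have hSm : #S ≤ m := by
    obtain ⟨q, hq⟩ := hQ0
    exact card_le_card_mul_left_of_injective hq (mul_right_injective₀ (hQ q hq).ne')
  have hQc : 0 < #Q := hQ0.card_pos
  have hm : #Q * #S ≤ m ^ 4 := by
    calc #Q * #S ≤ m * m := by gcongr
      _ = m ^ 2 := by ring
      _ ≤ m ^ 4 := Nat.pow_le_pow_right (by omega) (by norm_num)
  have key := card_incidences_cube_le Q S (Q * S) S hQ le_rfl hSm hm
  have hlow : #Q * #{p ∈ S ×ˢ S | p.1 + p.2 ∈ S} ≤
      #{p ∈ (Q ×ˢ S) ×ˢ S | p.1.1 * (p.1.2 + p.2) ∈ Q * S} := by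
    rw [← card_product]
    refine card_le_card_of_injOn (fun t ↦ ((t.1, t.2.1), t.2.2)) ?_ ?_
    · rintro ⟨q, u, y⟩ h
      simp only [coe_product, Set.mem_prod, mem_coe, mem_filter, mem_product] at h ⊢
      exact ⟨⟨⟨h.1, h.2.1.1⟩, h.2.1.2⟩, mul_mem_mul h.1 h.2.2⟩
    · rintro ⟨q, u, y⟩ _ ⟨q', u', y'⟩ _ h
      simp only [Prod.mk.injEq] at h ⊢
      tauto
  have h1 := (Nat.pow_le_pow_left hlow 3).trans key
  refine Nat.le_of_mul_le_mul_right ?_ (by positivity : 0 < #Q ^ 2)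
  calc _ = (#Q * #{p ∈ S ×ˢ S | p.1 + p.2 ∈ S}) ^ 3 := by ring
    _ ≤ _ := h1
    _ = _ := by ring

/-- Triangles in the Cayley graph of `S` restricted to `V`. -/
lemma card_triangles_sq_le (V S : Finset ℝ) :
    #{p ∈ V ×ˢ V ×ˢ V | p.1 - p.2.1 ∈ S ∧ p.2.1 - p.2.2 ∈ S ∧ p.1 - p.2.2 ∈ S} ^ 2 ≤
      #{p ∈ S ×ˢ S | p.1 + p.2 ∈ S} * ∑ x ∈ V - V, #{v ∈ V | x + v ∈ V} ^ 3 := by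
  set T : Finset (ℝ × ℝ × ℝ) :=
    {p ∈ V ×ˢ V ×ˢ V | p.1 - p.2.1 ∈ S ∧ p.2.1 - p.2.2 ∈ S ∧ p.1 - p.2.2 ∈ S} with hT
  refine (card_sq_le_card_mul_card_collisions T {p ∈ S ×ˢ S | p.1 + p.2 ∈ S}
    (fun p ↦ (p.1 - p.2.1, p.2.1 - p.2.2)) ?_).trans ?_
  · rintro ⟨g, h, k⟩ hp
    simp only [hT, mem_filter, mem_product] at hp ⊢
    refine ⟨⟨hp.2.1, hp.2.2.1⟩, ?_⟩
    have := hp.2.2.2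
    rwa [← sub_add_sub_cancel g h k] at this
  gcongr
  let F : ℝ → Finset ℝ := fun x ↦ {v ∈ V | x + v ∈ V}
  have : ∑ x ∈ V - V, #{v ∈ V | x + v ∈ V} ^ 3 =
      #((V - V).sigma fun x ↦ F x ×ˢ F x ×ˢ F x) := by
    rw [card_sigma]
    refine sum_congr rfl fun x _ ↦ ?_
    simp only [card_product, F]
    ring
  rw [this]
  refine card_le_card_of_injOn (fun t ↦ ⟨t.2.1 - t.1.1, t.1⟩) ?_ ?_
  · rintro ⟨⟨g, h, k⟩, g', h', k'⟩ hp
    simp only [coe_filter, hT, mem_filter, mem_product, Set.mem_ofPred_eq, Prod.mk.injEq] at hp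
    obtain ⟨⟨⟨⟨hg, hh, hk⟩, -⟩, ⟨hg', hh', hk'⟩, -⟩, h1, h2⟩ := hp
    have e1 : g' - g + h = h' := by linarith
    have e2 : g' - g + k = k' := by linarith
    simp only [F, coe_sigma, Set.mem_sigma_iff, mem_coe, mem_product, mem_filter, e1, e2,
      sub_add_cancel]
    exact ⟨sub_mem_sub hg' hg, ⟨hg, hg'⟩, ⟨hh, hh'⟩, hk, hk'⟩
  · rintro ⟨⟨g, h, k⟩, g', h', k'⟩ hp ⟨⟨i, j, l⟩, i', j', l'⟩ hp' heq
    simp only [coe_filter, mem_product, Set.mem_ofPred_eq, Prod.mk.injEq] at hp hp'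
    simp only [Sigma.mk.injEq, heq_eq_eq, Prod.mk.injEq] at heq
    obtain ⟨e, rfl, rfl, rfl⟩ := heq
    obtain ⟨-, h1, h2⟩ := hp
    obtain ⟨-, h3, h4⟩ := hp'
    simp only [Prod.mk.injEq, true_and]
    refine ⟨by linarith, by linarith, by linarith⟩

/-- Solymosi's argument: vector sums of points on consecutive rich lines through the origin. -/
lemma card_slopes_mul_sq_le_aux (A : Finset ℝ) (hA : ∀ a ∈ A, 0 < a) (t : ℕ) (U : Finset ℝ) :
    (∀ l ∈ U, t ≤ #{a ∈ A | l * a ∈ A}) → ∀ μ, (∀ l ∈ U, l ≤ μ) →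
      #U * t ^ 2 ≤ #{p ∈ (A + A) ×ˢ (A + A) | p.2 ≤ μ * p.1} + t ^ 2 := by
  induction U using Finset.induction_on_max with
  | empty => simp
  | insert a U hmax ih =>
    intro hU μ hμ
    rcases U.eq_empty_or_nonempty with rfl | hne
    · simp
    have haU : a ∉ U := fun h ↦ lt_irrefl _ (hmax a h)
    set ν := U.max' hne with hν
    have hνU : ν ∈ U := U.max'_mem hne
    have hνa : ν < a := hmax _ hνU
    have haμ : a ≤ μ := hμ a (mem_insert_self _ _)
    have ih' := ih (fun l hl ↦ hU l (mem_insert_of_mem hl)) ν (fun l hl ↦ U.le_max' l hl)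
    let F : ℝ → Finset ℝ := fun l ↦ {x ∈ A | l * x ∈ A}
    let I : Finset (ℝ × ℝ) := (F a ×ˢ F ν).image fun p ↦ (p.1 + p.2, a * p.1 + ν * p.2)
    have hI : t ^ 2 ≤ #I := by
      rw [card_image_of_injective, card_product, sq]
      · exact Nat.mul_le_mul (hU a (mem_insert_self _ _)) (hU ν (mem_insert_of_mem hνU))
      · rintro ⟨x, y⟩ ⟨x', y'⟩ h
        simp only [Prod.mk.injEq] at h
        have hx : x = x' := by
          apply mul_left_cancel₀ (sub_pos.2 hνa).ne'
          linear_combination h.2 - ν * h.1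
        subst hx
        simpa using h.1
    have hsub : {p ∈ (A + A) ×ˢ (A + A) | p.2 ≤ ν * p.1} ∪ I ⊆
        {p ∈ (A + A) ×ˢ (A + A) | p.2 ≤ μ * p.1} := by
      refine union_subset (fun p hp ↦ ?_) fun p hp ↦ ?_
      · simp only [mem_filter, mem_product] at hp ⊢
        refine ⟨hp.1, hp.2.trans ?_⟩
        obtain ⟨b, hb, c, hc, hbc⟩ := mem_add.1 hp.1.1
        have := hA b hb
        have := hA c hc
        have : 0 ≤ p.1 := by linarith
        gcongr
        linarith
      · obtain ⟨⟨x, y⟩, hxy, rfl⟩ := mem_image.1 hp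
        simp only [F, mem_product, mem_filter] at hxy ⊢
        have hx := hA x hxy.1.1
        have hy := hA y hxy.2.1
        refine ⟨⟨add_mem_add hxy.1.1 hxy.2.1, add_mem_add hxy.1.2 hxy.2.2⟩, ?_⟩
        nlinarith
    have hdisj : Disjoint ({p ∈ (A + A) ×ˢ (A + A) | p.2 ≤ ν * p.1}) I := by
      rw [disjoint_left]
      rintro p hp hpI
      obtain ⟨⟨x, y⟩, hxy, rfl⟩ := mem_image.1 hpI
      simp only [F, mem_product, mem_filter] at hxy hp
      have hx := hA x hxy.1.1
      have := hp.2
      nlinarith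
    have := card_le_card hsub
    rw [card_union_of_disjoint hdisj] at this
    rw [card_insert_of_notMem haU, add_mul, one_mul]
    omega

lemma card_slopes_mul_sq_le (A : Finset ℝ) (hA : ∀ a ∈ A, 0 < a) (t : ℕ) (U : Finset ℝ)
    (hU : ∀ l ∈ U, t ≤ #{a ∈ A | l * a ∈ A}) : #U * t ^ 2 ≤ 2 * #(A + A) ^ 2 := by
  rcases U.eq_empty_or_nonempty with rfl | hne
  · simp
  have h1 := card_slopes_mul_sq_le_aux A hA t U hU (U.max' hne) fun l hl ↦ U.le_max' l hl
  obtain ⟨l, hl⟩ := id hne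
  have h2 : t ≤ #(A + A) :=
    (hU l hl).trans ((card_filter_le _ _).trans card_le_card_add_self)
  have h3 := card_filter_le ((A + A) ×ˢ (A + A)) fun p ↦ p.2 ≤ U.max' hne * p.1
  rw [card_product] at h3
  have h4 : t ^ 2 ≤ #(A + A) ^ 2 := Nat.pow_le_pow_left h2 2
  nlinarith

/-- Solymosi's bound for the multiplicative energy. -/
lemma mulEnergy_le_of_pos (A : Finset ℝ) (hA : ∀ a ∈ A, 0 < a) :
    (mulEnergy A A : ℝ) ≤ 8 * (Nat.log 2 #A + 1) * (#(A + A) : ℝ) ^ 2 := by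
  let F : ℝ → Finset ℝ := fun l ↦ {x ∈ A | l * x ∈ A}
  have h1 : mulEnergy A A ≤ ∑ l ∈ A / A, #{x ∈ A | l * x ∈ A} ^ 2 := by
    have : ∑ l ∈ A / A, #{x ∈ A | l * x ∈ A} ^ 2 = #((A / A).sigma fun l ↦ F l ×ˢ F l) := by
      rw [card_sigma]
      exact sum_congr rfl fun l _ ↦ by simp only [card_product, F, sq]
    rw [this, mulEnergy]
    refine card_le_card_of_injOn (fun x ↦ ⟨x.1.1 / x.1.2, x.1.2, x.2.1⟩) ?_ ?_
    · rintro ⟨⟨a, b⟩, c, d⟩ h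
      simp only [coe_filter, mem_product, Set.mem_ofPred_eq] at h
      obtain ⟨⟨⟨ha, hb⟩, hc, hd⟩, e⟩ := h
      have hb0 := (hA b hb).ne'
      have e1 : a / b * b = a := by field_simp
      have e2 : a / b * c = d := by field_simp; linarith
      simp only [F, coe_sigma, Set.mem_sigma_iff, mem_coe, mem_product, mem_filter, e1, e2]
      exact ⟨div_mem_div ha hb, ⟨hb, ha⟩, hc, hd⟩
    · rintro ⟨⟨a, b⟩, c, d⟩ h ⟨⟨a', b'⟩, c', d'⟩ h' heq
      simp only [coe_filter, mem_product, Set.mem_ofPred_eq] at h h'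
      simp only [Sigma.mk.injEq, heq_eq_eq, Prod.mk.injEq] at heq
      obtain ⟨e, rfl, rfl⟩ := heq
      have hb0 := (hA b h.1.1.2).ne'
      have haa : a = a' := by field_simp at e; exact e
      subst haa
      have : d = d' := mul_left_cancel₀ hb0 (by rw [← h.2, h'.2])
      subst this
      rfl
  calc (mulEnergy A A : ℝ) ≤ ∑ l ∈ A / A, (#{x ∈ A | l * x ∈ A} : ℝ) ^ 2 := by exact_mod_cast h1
    _ ≤ 2 ^ 2 * (Nat.log 2 #A + 1) * (2 * (#(A + A) : ℝ) ^ 2) := by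
        refine sum_pow_le_of_card_superlevel_le _ _ (by norm_num)
          (fun x _ ↦ card_filter_le _ _) fun t _ ↦ ?_
        exact_mod_cast card_slopes_mul_sq_le A hA t _ fun l hl ↦ (mem_filter.1 hl).2
    _ = _ := by ring

/-- The Sidorenko-type lower bound for closed walks of length six in a bipartite graph. -/
lemma sum_sq_cube_le_card_cube_mul_closed_walks {α β : Type*} (V : Finset α) (G : Finset β)
    (b : α → β → ℝ) (M : α → α → ℝ) (hM : ∀ g h, M g h = ∑ c ∈ G, b g c * b h c) :
    (∑ c ∈ G, (∑ g ∈ V, b g c) ^ 2) ^ 3 ≤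
      (#V : ℝ) ^ 3 * ∑ g ∈ V, ∑ h ∈ V, ∑ k ∈ V, M g h * M h k * M g k := by
  set W := ∑ g ∈ V, ∑ h ∈ V, ∑ k ∈ V, M g h * M h k * M g k with hW
  let e : β → ℝ := fun c ↦ ∑ g ∈ V, b g c
  let d : α → ℝ := fun h ↦ ∑ c ∈ G, e c * b h c
  let f : β → ℝ := fun c ↦ ∑ h ∈ V, d h * b h c
  set m₁ := ∑ c ∈ G, e c ^ 2 with hm₁
  set m₂ := ∑ h ∈ V, d h ^ 2 with hm₂
  set m₃ := ∑ c ∈ G, f c ^ 2 with hm₃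
  have hd : ∀ h, d h = ∑ g ∈ V, M g h := fun h ↦ by
    simp only [d, e, hM, sum_mul]
    rw [sum_comm]
  have hdsum : ∑ h ∈ V, d h = m₁ := by
    simp only [d, hm₁]
    rw [sum_comm]
    refine sum_congr rfl fun c _ ↦ ?_
    rw [← mul_sum, sq]
  have h12 : m₁ ^ 2 ≤ #V * m₂ := by
    rw [← hdsum]
    exact sq_sum_le_card_mul_sum_sq
  have hm₂' : m₂ = ∑ c ∈ G, e c * f c := by
    simp only [hm₂, f, mul_sum]
    rw [sum_comm]
    refine sum_congr rfl fun h _ ↦ ?_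
    rw [sq]
    conv_lhs => arg 2; simp only [d]
    rw [mul_sum]
    exact sum_congr rfl fun c _ ↦ by ring
  have h23 : m₂ ^ 2 ≤ m₁ * m₃ := by
    rw [hm₂']
    exact sum_mul_sq_le_sq_mul_sq _ _ _
  have hW' : W = ∑ c ∈ G, ∑ g ∈ V, (∑ h ∈ V, M g h * b h c) ^ 2 := by
    rw [hW, sum_comm (s := G)]
    refine sum_congr rfl fun g _ ↦ ?_
    simp only [sq, sum_mul_sum]
    rw [sum_comm (s := G)]
    refine sum_congr rfl fun h _ ↦ ?_
    rw [sum_comm (s := G)]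
    refine sum_congr rfl fun k _ ↦ ?_
    rw [hM h k, mul_sum, sum_mul]
    exact sum_congr rfl fun c _ ↦ by ring
  have h3 : m₃ ≤ #V * W := by
    rw [hW', mul_sum]
    refine sum_le_sum fun c _ ↦ ?_
    have : f c = ∑ g ∈ V, ∑ h ∈ V, M g h * b h c := by
      simp only [f]
      rw [sum_comm]
      exact sum_congr rfl fun h _ ↦ by rw [hd, sum_mul]
    rw [this]
    exact sq_sum_le_card_mul_sum_sq
  have hm₁0 : 0 ≤ m₁ := sum_nonneg fun _ _ ↦ sq_nonneg _
  have hm₂0 : 0 ≤ m₂ := sum_nonneg fun _ _ ↦ sq_nonneg _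
  change m₁ ^ 3 ≤ _
  rcases hm₁0.eq_or_lt with h0 | h0
  · have hm₃0 : 0 ≤ m₃ := sum_nonneg fun _ _ ↦ sq_nonneg _
    rw [← h0]
    calc (0 : ℝ) ^ 3 ≤ (#V : ℝ) ^ 2 * m₃ := by rw [zero_pow (by norm_num)]; positivity
      _ ≤ (#V : ℝ) ^ 2 * (#V * W) := by gcongr
      _ = _ := by ring
  · refine le_of_mul_le_mul_left ?_ h0
    calc m₁ * m₁ ^ 3 = (m₁ ^ 2) ^ 2 := by ring
      _ ≤ (#V * m₂) ^ 2 := by gcongr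
      _ = (#V : ℝ) ^ 2 * m₂ ^ 2 := by ring
      _ ≤ (#V : ℝ) ^ 2 * (m₁ * m₃) := by gcongr
      _ ≤ (#V : ℝ) ^ 2 * (m₁ * (#V * W)) := by gcongr
      _ = _ := by ring

/-- Weighted triangles are controlled by the number of triangles in the support and the
row norms of the weight. -/
lemma sum_triangles_le {α : Type*} [DecidableEq α] (V : Finset α) (M : α → α → ℝ)
    (T : Finset (α × α × α)) (hM0 : ∀ g h, 0 ≤ M g h) (hsymm : ∀ g h, M g h = M h g) {E H : ℝ}
    (hE : ∀ g, ∑ k ∈ V, M g k ^ 2 ≤ E)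
    (hT : ∀ g ∈ V, ∀ h ∈ V, ∀ k ∈ V, M g h ≠ 0 → M h k ≠ 0 → M g k ≠ 0 → (g, h, k) ∈ T)
    (hH : 0 < H) :
    ∑ g ∈ V, ∑ h ∈ V, ∑ k ∈ V, M g h * M h k * M g k ≤ H ^ 3 * #T + 3 * (#V * E ^ 2 / H) := by
  have hpt : ∀ g ∈ V, ∀ h ∈ V, ∀ k ∈ V, M g h * M h k * M g k ≤
      (if (g, h, k) ∈ T then H ^ 3 else 0) + (M g h ^ 2 * (M h k * M g k) / H +
        M h k ^ 2 * (M g h * M g k) / H + M g k ^ 2 * (M g h * M h k) / H) := by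
    intro g hg h hh k hk
    have hx := hM0 g h
    have hy := hM0 h k
    have hz := hM0 g k
    have hif : (0 : ℝ) ≤ if (g, h, k) ∈ T then H ^ 3 else 0 := by split_ifs <;> positivity
    have heavy : ∀ x w : ℝ, 0 ≤ w → H < x → x * w ≤ x ^ 2 * w / H := by
      intro x w hw hx
      rw [le_div_iff₀ hH]
      have : 0 ≤ x * w := by have := hH.trans hx; positivity
      nlinarith
    have p1 : 0 ≤ M g h ^ 2 * (M h k * M g k) / H := by positivity
    have p2 : 0 ≤ M h k ^ 2 * (M g h * M g k) / H := by positivity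
    have p3 : 0 ≤ M g k ^ 2 * (M g h * M h k) / H := by positivity
    by_cases h0 : M g h * M h k * M g k = 0
    · rw [h0]; positivity
    have hmem : (g, h, k) ∈ T := hT g hg h hh k hk (by rintro h; simp [h] at h0)
      (by rintro h; simp [h] at h0) (by rintro h; simp [h] at h0)
    rw [if_pos hmem]
    have hH3 : 0 < H ^ 3 := by positivity
    rcases le_or_gt (M g h) H with h1 | h1
    · rcases le_or_gt (M h k) H with h2 | h2
      · rcases le_or_gt (M g k) H with h3 | h3
        · have : M g h * M h k * M g k ≤ H * H * H := by gcongr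
          have e : H * H * H = H ^ 3 := by ring
          linarith
        · have := heavy _ (M g h * M h k) (by positivity) h3
          linarith
      · have := heavy _ (M g h * M g k) (by positivity) h2
        linarith
    · have := heavy _ (M h k * M g k) (by positivity) h1
      linarith
  have hinner : ∀ g h, ∑ k ∈ V, M g k * M h k ≤ E := by
    intro g h
    calc ∑ k ∈ V, M g k * M h k ≤ ∑ k ∈ V, (M g k ^ 2 / 2 + M h k ^ 2 / 2) :=
          sum_le_sum fun k _ ↦ by nlinarith [sq_nonneg (M g k - M h k)]
      _ = (∑ k ∈ V, M g k ^ 2) / 2 + (∑ k ∈ V, M h k ^ 2) / 2 := by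
          rw [sum_add_distrib, sum_div, sum_div]
      _ ≤ E := by linarith [hE g, hE h]
  have hpath : ∑ g ∈ V, ∑ h ∈ V, ∑ k ∈ V, M g h ^ 2 * (M h k * M g k) ≤ #V * E ^ 2 := by
    calc _ ≤ ∑ g ∈ V, ∑ h ∈ V, M g h ^ 2 * E := by
          refine sum_le_sum fun g _ ↦ sum_le_sum fun h _ ↦ ?_
          rw [← mul_sum]
          exact mul_le_mul_of_nonneg_left (hinner h g) (sq_nonneg _)
      _ ≤ ∑ _g ∈ V, E * E := by
          refine sum_le_sum fun g _ ↦ ?_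
          rw [← sum_mul]
          have hE0 : 0 ≤ E := (sum_nonneg fun _ _ ↦ sq_nonneg _).trans (hE g)
          exact mul_le_mul_of_nonneg_right (hE g) hE0
      _ = _ := by rw [sum_const, nsmul_eq_mul, sq]
  have hpath2 : ∑ g ∈ V, ∑ h ∈ V, ∑ k ∈ V, M h k ^ 2 * (M g h * M g k) ≤ #V * E ^ 2 := by
    refine le_of_eq_of_le ?_ hpath
    rw [sum_comm]
    refine sum_congr rfl fun h _ ↦ ?_
    rw [sum_comm]
    refine sum_congr rfl fun k _ ↦ sum_congr rfl fun g _ ↦ ?_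
    rw [hsymm g h, hsymm g k]
    ring
  have hpath3 : ∑ g ∈ V, ∑ h ∈ V, ∑ k ∈ V, M g k ^ 2 * (M g h * M h k) ≤ #V * E ^ 2 := by
    refine le_of_eq_of_le ?_ hpath
    refine sum_congr rfl fun g _ ↦ ?_
    rw [sum_comm]
    refine sum_congr rfl fun k _ ↦ sum_congr rfl fun h _ ↦ ?_
    rw [hsymm h k]
    ring
  have hcount : ∑ g ∈ V, ∑ h ∈ V, ∑ k ∈ V, (if (g, h, k) ∈ T then H ^ 3 else 0) ≤
      H ^ 3 * #T := by
    have : ∑ g ∈ V, ∑ h ∈ V, ∑ k ∈ V, (if (g, h, k) ∈ T then H ^ 3 else 0) =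
        ∑ p ∈ V ×ˢ V ×ˢ V, if p ∈ T then H ^ 3 else 0 := by
      simp only [sum_product]
    rw [this, ← sum_filter, sum_const, nsmul_eq_mul, mul_comm]
    have : #{p ∈ V ×ˢ V ×ˢ V | p ∈ T} ≤ #T :=
      card_le_card fun p hp ↦ (mem_filter.1 hp).2
    gcongr
  calc _ ≤ ∑ g ∈ V, ∑ h ∈ V, ∑ k ∈ V,
        ((if (g, h, k) ∈ T then H ^ 3 else 0) + (M g h ^ 2 * (M h k * M g k) / H +
        M h k ^ 2 * (M g h * M g k) / H + M g k ^ 2 * (M g h * M h k) / H)) :=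
        sum_le_sum fun g hg ↦ sum_le_sum fun h hh ↦ sum_le_sum fun k hk ↦ hpt g hg h hh k hk
    _ = ∑ g ∈ V, ∑ h ∈ V, ∑ k ∈ V, (if (g, h, k) ∈ T then H ^ 3 else 0) +
        ((∑ g ∈ V, ∑ h ∈ V, ∑ k ∈ V, M g h ^ 2 * (M h k * M g k)) / H +
        (∑ g ∈ V, ∑ h ∈ V, ∑ k ∈ V, M h k ^ 2 * (M g h * M g k)) / H +
        (∑ g ∈ V, ∑ h ∈ V, ∑ k ∈ V, M g k ^ 2 * (M g h * M h k)) / H) := by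
        simp only [sum_add_distrib, sum_div]
    _ ≤ H ^ 3 * #T + (#V * E ^ 2 / H + #V * E ^ 2 / H + #V * E ^ 2 / H) := by gcongr
    _ = _ := by ring

/-- The weight counting common neighbours in the incidence graph between dilates of `A` and
points has row norms at most the multiplicative energy of `A`. -/
lemma sum_card_common_dilates_sq_le (A G V : Finset ℝ) (hA : ∀ a ∈ A, a ≠ 0)
    (hG : ∀ c ∈ G, c ≠ 0) (g : ℝ) :
    ∑ k ∈ V, #{c ∈ G | c⁻¹ * g ∈ A ∧ c⁻¹ * k ∈ A} ^ 2 ≤ mulEnergy A A := by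
  let F : ℝ → Finset ℝ := fun k ↦ {c ∈ G | c⁻¹ * g ∈ A ∧ c⁻¹ * k ∈ A}
  have : ∑ k ∈ V, #{c ∈ G | c⁻¹ * g ∈ A ∧ c⁻¹ * k ∈ A} ^ 2 =
      #(V.sigma fun k ↦ F k ×ˢ F k) := by
    rw [card_sigma]
    exact sum_congr rfl fun k _ ↦ by simp only [card_product, F, sq]
  rw [this, mulEnergy]
  refine card_le_card_of_injOn (fun t ↦ ((t.2.1⁻¹ * g, t.2.2⁻¹ * g), t.2.2⁻¹ * t.1,
    t.2.1⁻¹ * t.1)) ?_ ?_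
  · rintro ⟨k, c, c'⟩ h
    simp only [F, coe_sigma, Set.mem_sigma_iff, mem_coe, mem_product, mem_filter] at h
    simp only [coe_filter, mem_product, Set.mem_ofPred_eq]
    refine ⟨⟨⟨h.2.1.2.1, h.2.2.2.1⟩, h.2.2.2.2, h.2.1.2.2⟩, by ring⟩
  · rintro ⟨k, c, c'⟩ h ⟨l, d, d'⟩ h' heq
    simp only [F, coe_sigma, Set.mem_sigma_iff, mem_coe, mem_product, mem_filter] at h h'
    simp only [Prod.mk.injEq] at heq
    obtain ⟨⟨h1, h2⟩, h3, h4⟩ := heq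
    have hg : g ≠ 0 := by
      rintro rfl
      exact hA _ h.2.1.2.1 (by simp)
    have hc : c = d := inv_injective (mul_right_cancel₀ hg h1)
    have hc' : c' = d' := inv_injective (mul_right_cancel₀ hg h2)
    subst hc hc'
    have : k = l := mul_left_cancel₀ (inv_ne_zero (hG c h.2.1.1)) h4
    subst this
    rfl

/-- Plünnecke's inequality for sets of positive reals. -/
lemma card_pow_le_of_pos (A : Finset ℝ) (hA : ∀ a ∈ A, 0 < a) (hne : A.Nonempty) (j : ℕ) :
    (#(A ^ j) : ℝ) ≤ ((#(A ^ 3) : ℝ) / #(A ^ 2)) ^ j * #(A ^ 2) := by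
  classical
  have hinj : Function.Injective (Units.coeHom ℝ) := Units.val_injective
  obtain ⟨B, rfl⟩ : ∃ B : Finset ℝˣ, B.image (Units.coeHom ℝ) = A := by
    refine ⟨A.preimage _ hinj.injOn, ?_⟩
    rw [image_preimage, filter_true_of_mem]
    intro a ha
    exact ⟨Units.mk0 a (hA a ha).ne', rfl⟩
  have hcard : ∀ i, #((B.image (Units.coeHom ℝ)) ^ i) = #(B ^ i) := fun i ↦ by
    rw [← image_pow, card_image_of_injective _ hinj]
  have hB : B.Nonempty := by simpa using hne
  have := pluennecke_ruzsa_inequality_pow_mul (hB.pow (n := 2)) B j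
  rw [← pow_succ] at this
  rw [hcard, hcard, hcard]
  have h := (NNRat.cast_le (K := ℝ)).2 this
  push_cast at h
  exact h

/-- Dilates of `A` by `A ^ 2` produce many triangles with differences in `A ^ 2 * (A - A)`. -/
lemma exists_triangle_weight (A : Finset ℝ) (hA : ∀ a ∈ A, 0 < a) :
    ∃ W : ℝ, ((#(A ^ 2) : ℝ) * (#A : ℝ) ^ 2) ^ 3 ≤ (#(A ^ 3) : ℝ) ^ 3 * W ∧
      ∀ H : ℝ, 0 < H → W ≤ H ^ 3 *
        #{p ∈ (A ^ 3 : Finset ℝ) ×ˢ (A ^ 3 : Finset ℝ) ×ˢ (A ^ 3 : Finset ℝ) |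
          p.1 - p.2.1 ∈ A ^ 2 * (A - A) ∧
          p.2.1 - p.2.2 ∈ A ^ 2 * (A - A) ∧ p.1 - p.2.2 ∈ A ^ 2 * (A - A)} +
        3 * (#(A ^ 3) * (mulEnergy A A : ℝ) ^ 2 / H) := by
  have hA2 : ∀ c ∈ A ^ 2, 0 < c := by
    intro c hc
    rw [sq] at hc
    obtain ⟨a, ha, b, hb, rfl⟩ := mem_mul.1 hc
    exact mul_pos (hA a ha) (hA b hb)
  let b : ℝ → ℝ → ℝ := fun g c ↦ if c⁻¹ * g ∈ A then 1 else 0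
  let M : ℝ → ℝ → ℝ := fun g h ↦ #{c ∈ A ^ 2 | c⁻¹ * g ∈ A ∧ c⁻¹ * h ∈ A}
  have hM : ∀ g h, M g h = ∑ c ∈ A ^ 2, b g c * b h c := by
    intro g h
    simp only [M, b, card_filter]
    push_cast
    refine sum_congr rfl fun c _ ↦ ?_
    by_cases h1 : c⁻¹ * g ∈ A <;> by_cases h2 : c⁻¹ * h ∈ A <;> simp [h1, h2]
  have hdeg : ∀ c ∈ A ^ 2, ∑ g ∈ A ^ 3, b g c = #A := by
    intro c hc
    have hc0 := (hA2 c hc).ne'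
    simp only [b]
    rw [← sum_filter, sum_const, nsmul_eq_mul, mul_one]
    have : {g ∈ A ^ 3 | c⁻¹ * g ∈ A} = A.image fun a ↦ c * a := by
      ext g
      simp only [mem_filter, mem_image]
      constructor
      · rintro ⟨-, h⟩
        exact ⟨_, h, by field_simp⟩
      · rintro ⟨a, ha, rfl⟩
        refine ⟨?_, by rwa [inv_mul_cancel_left₀ hc0]⟩
        rw [pow_succ]
        exact mul_mem_mul hc ha
    rw [this, card_image_of_injective _ (mul_right_injective₀ hc0)]
  refine ⟨∑ g ∈ A ^ 3, ∑ h ∈ A ^ 3, ∑ k ∈ A ^ 3, M g h * M h k * M g k, ?_, fun H hH ↦ ?_⟩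
  · have := sum_sq_cube_le_card_cube_mul_closed_walks (A ^ 3) (A ^ 2) b M hM
    rwa [sum_congr rfl fun c hc ↦ by rw [hdeg c hc], sum_const, nsmul_eq_mul] at this
  · refine sum_triangles_le (A ^ 3) M _ (fun g h ↦ by positivity)
      (fun g h ↦ by simp only [M, and_comm]) (fun g ↦ ?_) ?_ hH
    · have := sum_card_common_dilates_sq_le A (A ^ 2) (A ^ 3) (fun a ha ↦ (hA a ha).ne')
        (fun c hc ↦ (hA2 c hc).ne') g
      simp only [M]
      exact_mod_cast this
    · have hS : ∀ g h, M g h ≠ 0 → g - h ∈ A ^ 2 * (A - A) := by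
        intro g h hgh
        have hne : #{c ∈ A ^ 2 | c⁻¹ * g ∈ A ∧ c⁻¹ * h ∈ A} ≠ 0 := fun h0 ↦ hgh (by simp [M, h0])
        obtain ⟨c, hc⟩ := card_ne_zero.1 hne
        obtain ⟨hc, h1, h2⟩ := mem_filter.1 hc
        have hc0 := (hA2 c hc).ne'
        exact mem_mul.2 ⟨c, hc, _, sub_mem_sub h1 h2, by field_simp⟩
      intro g hg h hh k hk h1 h2 h3
      simp only [mem_filter, mem_product]
      exact ⟨⟨hg, hh, hk⟩, hS _ _ h1, hS _ _ h2, hS _ _ h3⟩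

lemma pow_le_of_triangle_bounds {n s P Z E d T τ R W mS mV S L : ℝ} (hn : 0 < n)
    (hP : 0 < P) (hZ : 0 < Z) (hE : 0 < E) (hd : 0 ≤ d) (hR : 0 ≤ R)
    (hmS : 0 ≤ mS) (hmV : 0 ≤ mV) (hS : 0 ≤ S) (hL : 0 ≤ L)
    (hW : (P * n ^ 2) ^ 3 ≤ Z ^ 3 * W)
    (hWle : ∀ H : ℝ, 0 < H → W ≤ H ^ 3 * τ + 3 * (Z * E ^ 2 / H))
    (hτ2 : τ ^ 2 ≤ T * R) (hT3 : T ^ 3 * P ≤ 332 * mS ^ 4 * S ^ 2)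
    (hRle : R ≤ 8 * (3 * L) * (332 * mV ^ 4 / P))
    (hmVle : mV ≤ (Z / P) ^ 5 * P) (hmSle : mS ≤ (Z / P) ^ 4 * P * d) (hSle : S ≤ P * d)
    (hEle : E ≤ 8 * L * s ^ 2) (hdle : d * n ≤ s ^ 2) (hPE : n ^ 4 ≤ P * E) :
    n ^ 686 ≤ 432 ^ 6 * 332 * 7968 ^ 3 * 8 ^ 170 * (L ^ 173 * Z ^ 166 * s ^ 352) := by
  have hW0 : 0 < W := by
    have : 0 < Z ^ 3 * W := lt_of_lt_of_le (by positivity) hW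
    exact pos_of_mul_pos_right this (by positivity)
  have hW4 : W ^ 4 ≤ 432 * Z ^ 3 * E ^ 6 * τ := by
    have h := hWle (6 * Z * E ^ 2 / W) (by positivity)
    have e1 : 3 * (Z * E ^ 2 / (6 * Z * E ^ 2 / W)) = W / 2 := by field_simp; norm_num
    rw [e1] at h
    have h' : W ≤ 2 * ((6 * Z * E ^ 2 / W) ^ 3 * τ) := by linarith
    calc W ^ 4 = W ^ 3 * W := by ring
      _ ≤ W ^ 3 * (2 * ((6 * Z * E ^ 2 / W) ^ 3 * τ)) := by gcongr
      _ = _ := by field_simp; ring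
  have hT3' : T ^ 3 ≤ 332 * ((Z / P) ^ 16 * P ^ 5 * d ^ 6) := by
    refine le_of_mul_le_mul_right ?_ hP
    calc T ^ 3 * P ≤ 332 * mS ^ 4 * S ^ 2 := hT3
      _ ≤ 332 * ((Z / P) ^ 4 * P * d) ^ 4 * (P * d) ^ 2 := by gcongr
      _ = _ := by ring
  have hR3 : R ^ 3 ≤ 7968 ^ 3 * L ^ 3 * ((Z / P) ^ 60 * P ^ 9) := by
    calc R ^ 3 ≤ (8 * (3 * L) * (332 * ((Z / P) ^ 5 * P) ^ 4 / P)) ^ 3 := by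
          gcongr
          exact hRle.trans (by gcongr)
      _ = _ := by field_simp; ring
  have hτ6 : τ ^ 6 ≤ 332 * 7968 ^ 3 * L ^ 3 * (Z ^ 76 / P ^ 62 * d ^ 6) := by
    calc τ ^ 6 = (τ ^ 2) ^ 3 := by ring
      _ ≤ (T * R) ^ 3 := by gcongr
      _ = T ^ 3 * R ^ 3 := by ring
      _ ≤ 332 * ((Z / P) ^ 16 * P ^ 5 * d ^ 6) *
          (7968 ^ 3 * L ^ 3 * ((Z / P) ^ 60 * P ^ 9)) := by gcongr
      _ = _ := by field_simp
  have hmain : P ^ 134 * n ^ 144 ≤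
      432 ^ 6 * 332 * 7968 ^ 3 * L ^ 3 * Z ^ 166 * E ^ 36 * d ^ 6 := by
    calc P ^ 134 * n ^ 144 = ((P * n ^ 2) ^ 3) ^ 24 * P ^ 62 := by ring
      _ ≤ (Z ^ 3 * W) ^ 24 * P ^ 62 := by gcongr
      _ = Z ^ 72 * (W ^ 4) ^ 6 * P ^ 62 := by ring
      _ ≤ Z ^ 72 * (432 * Z ^ 3 * E ^ 6 * τ) ^ 6 * P ^ 62 := by gcongr
      _ = 432 ^ 6 * Z ^ 90 * E ^ 36 * τ ^ 6 * P ^ 62 := by ring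
      _ ≤ 432 ^ 6 * Z ^ 90 * E ^ 36 * (332 * 7968 ^ 3 * L ^ 3 * (Z ^ 76 / P ^ 62 * d ^ 6)) *
          P ^ 62 := by gcongr
      _ = _ := by field_simp
  calc n ^ 686 = (n ^ 4) ^ 134 * n ^ 150 := by ring
    _ ≤ (P * E) ^ 134 * n ^ 150 := by gcongr
    _ = E ^ 134 * n ^ 6 * (P ^ 134 * n ^ 144) := by ring
    _ ≤ E ^ 134 * n ^ 6 * (432 ^ 6 * 332 * 7968 ^ 3 * L ^ 3 * Z ^ 166 * E ^ 36 * d ^ 6) := by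
        gcongr
    _ = 432 ^ 6 * 332 * 7968 ^ 3 * (L ^ 3 * Z ^ 166 * E ^ 170 * (d * n) ^ 6) := by ring
    _ ≤ 432 ^ 6 * 332 * 7968 ^ 3 * (L ^ 3 * Z ^ 166 * (8 * L * s ^ 2) ^ 170 * (s ^ 2) ^ 6) := by
        gcongr
    _ = _ := by simp only [mul_pow, ← pow_mul]; ring

/-- A lower bound for the threefold product set of a set of positive reals. -/
lemma card_pow_le_of_pos_set (A : Finset ℝ) (hA : ∀ a ∈ A, 0 < a) (hne : A.Nonempty) :
    (#A : ℝ) ^ 686 ≤ 432 ^ 6 * 332 * 7968 ^ 3 * 8 ^ 170 *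
      (((Nat.log 2 #A : ℝ) + 1) ^ 173 * (#(A ^ 3) : ℝ) ^ 166 * (#(A + A) : ℝ) ^ 352) := by
  have hpow : ∀ j : ℕ, (A ^ j).Nonempty := fun j ↦ hne.pow
  have hA2 : ∀ c ∈ A ^ 2, 0 < c := by
    intro c hc
    rw [sq] at hc
    obtain ⟨a, ha, b, hb, rfl⟩ := mem_mul.1 hc
    exact mul_pos (hA a ha) (hA b hb)
  have pos : ∀ B : Finset ℝ, B.Nonempty → (0 : ℝ) < #B := fun B hB ↦ by
    exact_mod_cast hB.card_pos
  have one_le : ∀ B : Finset ℝ, B.Nonempty → (1 : ℝ) ≤ #B := fun B hB ↦ by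
    exact_mod_cast hB.card_pos
  rcases (Nat.one_le_iff_ne_zero.2 hne.card_pos.ne').eq_or_lt with h1 | h1
  · rw [← h1]
    have hZ := one_le_pow₀ (one_le _ (hpow 3)) (n := 166)
    have hs := one_le_pow₀ (one_le _ (hne.add hne)) (n := 352)
    calc ((1 : ℕ) : ℝ) ^ 686 ≤ 432 ^ 6 * 332 * 7968 ^ 3 * 8 ^ 170 * (1 * 1 * 1) := by norm_num
      _ ≤ _ := by
        gcongr
        simp
  obtain ⟨a, ha, b, hb, hab⟩ := one_lt_card.1 h1
  obtain ⟨W, hW, hWle⟩ := exists_triangle_weight A hA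
  have h5 : A ^ 2 * A ^ 3 = A ^ 5 := (pow_add A 2 3).symm
  have h4 : A ^ 2 * (A ^ 2 * (A - A)) = A ^ 4 * (A - A) := by rw [← mul_assoc, ← pow_add]
  have haa : a ^ 2 ∈ A ^ 2 := pow_mem_pow ha
  have ha0 := hA a ha
  have hc25 : #(A ^ 2) ≤ #(A ^ 2 * A ^ 3) :=
    card_le_card_mul_right_of_injective (pow_mem_pow ha : a ^ 3 ∈ A ^ 3)
      (mul_left_injective₀ (by positivity))
  have hc2S : #(A ^ 2) ≤ #(A ^ 2 * (A ^ 2 * (A - A))) :=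
    card_le_card_mul_right_of_injective (mul_mem_mul haa (sub_mem_sub ha hb))
      (mul_left_injective₀ (mul_ne_zero (by positivity) (sub_ne_zero.2 hab)))
  have hR := sum_card_translates_cube_le (A ^ 2) (A ^ 3) hA2 (hpow 2) hc25
  have hT := card_sum_pairs_cube_le (A ^ 2) (A ^ 2 * (A - A)) hA2 (hpow 2) hc2S
  have hτ := card_triangles_sq_le (A ^ 3) (A ^ 2 * (A - A))
  have hlog : (Nat.log 2 #(A ^ 3) : ℝ) + 1 ≤ 3 * ((Nat.log 2 #A : ℝ) + 1) := by
    have : Nat.log 2 #(A ^ 3) < 3 * (Nat.log 2 #A + 1) := by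
      refine Nat.log_lt_of_lt_pow (hpow 3).card_pos.ne' ?_
      rw [mul_comm, pow_mul]
      exact card_pow_le.trans_lt
        (Nat.pow_lt_pow_left (Nat.lt_pow_succ_log_self (by norm_num) _) (by norm_num))
    exact_mod_cast this
  have hZ := pos _ (hpow 3)
  have hP := pos _ (hpow 2)
  refine pow_le_of_triangle_bounds (P := #(A ^ 2)) (E := mulEnergy A A) (d := #(A - A))
    (T := #{p ∈ (A ^ 2 * (A - A)) ×ˢ (A ^ 2 * (A - A)) | p.1 + p.2 ∈ A ^ 2 * (A - A)})
    (R := ∑ x ∈ A ^ 3 - A ^ 3, (#{v ∈ A ^ 3 | x + v ∈ A ^ 3} : ℝ) ^ 3)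
    (mS := #(A ^ 2 * (A ^ 2 * (A - A)))) (mV := #(A ^ 2 * A ^ 3)) (S := #(A ^ 2 * (A - A)))
    (pos _ hne) hP hZ ?_ (Nat.cast_nonneg _) (sum_nonneg fun _ _ ↦ by positivity)
    (Nat.cast_nonneg _) (Nat.cast_nonneg _) (Nat.cast_nonneg _) (by positivity) hW hWle
    (by exact_mod_cast hτ) (by exact_mod_cast hT) ?_ ?_ ?_ (by exact_mod_cast card_mul_le)
    (mulEnergy_le_of_pos A hA) ?_ ?_
  · exact_mod_cast mulEnergy_pos hne hne
  · refine hR.trans ?_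
    gcongr
  · rw [h5]
    exact card_pow_le_of_pos A hA hne 5
  · rw [h4]
    calc (#(A ^ 4 * (A - A)) : ℝ) ≤ #(A ^ 4) * #(A - A) := by exact_mod_cast card_mul_le
      _ ≤ _ := by
        gcongr
        exact card_pow_le_of_pos A hA hne 4
  · have := ruzsa_triangle_inequality_sub_add_add A A A
    rw [sq]
    exact_mod_cast this
  · have := le_card_mul_mul_mulEnergy A A
    rw [← sq A, ← pow_add] at this
    exact_mod_cast this

/-- One of the two half-lines contains a positive proportion of `A`, up to a reflection. -/
lemma exists_pos_set_card_le (A : Finset ℝ) (hA : 2 ≤ #A) :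
    ∃ B : Finset ℝ, (∀ b ∈ B, 0 < b) ∧ B.Nonempty ∧ #A ≤ 4 * #B ∧ #B ≤ #A ∧
      #(B + B) ≤ #(A + A) ∧ #(B ^ 3) ≤ #(A * A * A) := by
  have hA3 : A * A * A = A ^ 3 := by rw [pow_succ, sq]
  have hcard : #A ≤ #{a ∈ A | 0 < a} + #{a ∈ A | a < 0} + 1 := by
    have : A ⊆ {a ∈ A | 0 < a} ∪ {a ∈ A | a < 0} ∪ {0} := by
      intro a ha
      rcases lt_trichotomy a 0 with h | h | h <;> simp [ha, h]
    refine (card_le_card this).trans ((card_union_le _ _).trans ?_)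
    simpa using card_union_le _ _
  rw [hA3]
  rcases le_total #{a ∈ A | a < 0} #{a ∈ A | 0 < a} with h | h
  · have hsub : {a ∈ A | 0 < a} ⊆ A := filter_subset _ _
    refine ⟨{a ∈ A | 0 < a}, fun b hb ↦ (mem_filter.1 hb).2, card_pos.1 (by lia), by lia,
      card_le_card hsub, card_le_card (add_subset_add hsub hsub),
      card_le_card (pow_subset_pow_left hsub)⟩
  · have hsub : {a ∈ A | a < 0} ⊆ A := filter_subset _ _
    refine ⟨-{a ∈ A | a < 0}, fun b hb ↦ ?_, card_pos.1 (by rw [card_neg]; lia),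
      by rw [card_neg]; lia, ?_, ?_, ?_⟩
    · have := (mem_filter.1 (mem_neg'.1 hb)).2
      linarith
    · rw [card_neg]
      exact card_le_card hsub
    · rw [← neg_add, card_neg]
      exact card_le_card (add_subset_add hsub hsub)
    · rw [Odd.neg_pow (by decide), card_neg]
      exact card_le_card (pow_subset_pow_left hsub)

lemma exists_card_pow_le :
    ∃ c : ℝ, 1 ≤ c ∧ ∀ A : Finset ℝ, 2 ≤ #A → (#A : ℝ) ^ 686 ≤
      c * (Real.logb 2 #A ^ 173 * (#(A * A * A) : ℝ) ^ 166 * (#(A + A) : ℝ) ^ 352) := by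
  obtain ⟨c, hc, h⟩ : ∃ c : ℝ, 1 ≤ c ∧ ∀ A : Finset ℝ, (∀ a ∈ A, 0 < a) → A.Nonempty →
      (#A : ℝ) ^ 686 ≤ c * (((Nat.log 2 #A : ℝ) + 1) ^ 173 * (#(A ^ 3) : ℝ) ^ 166 *
        (#(A + A) : ℝ) ^ 352) :=
    ⟨_, by norm_num, fun A hA hne ↦ card_pow_le_of_pos_set A hA hne⟩
  obtain ⟨q, hq⟩ : ∃ q : ℝ, q = 4 := ⟨4, rfl⟩
  obtain ⟨r, hr⟩ : ∃ r : ℝ, r = 2 := ⟨2, rfl⟩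
  have hq0 : 1 ≤ q := by linarith
  have hr0 : 1 ≤ r := by linarith
  refine ⟨q ^ 686 * c * r ^ 173, one_le_mul_of_one_le_of_one_le
    (one_le_mul_of_one_le_of_one_le (one_le_pow₀ hq0) hc) (one_le_pow₀ hr0), fun A hA ↦ ?_⟩
  obtain ⟨B, hB, hB0, hAB, hBA, hadd, hmul⟩ := exists_pos_set_card_le A hA
  have hlog1 : 1 ≤ Real.logb 2 #A := by
    rw [Real.le_logb_iff_rpow_le (by norm_num) (by positivity), Real.rpow_one]
    exact_mod_cast hA
  have hlog : (Nat.log 2 #B : ℝ) + 1 ≤ r * Real.logb 2 #A := by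
    rw [hr]
    have h1 : (Nat.log 2 #B : ℝ) ≤ Nat.log 2 #A := by exact_mod_cast Nat.log_mono_right hBA
    have h2 : (Nat.log 2 #A : ℝ) ≤ Real.logb 2 #A := by exact_mod_cast Real.natLog_le_logb _ 2
    linarith
  calc (#A : ℝ) ^ 686 ≤ (q * #B) ^ 686 := by
        gcongr
        rw [hq]
        exact_mod_cast hAB
    _ = q ^ 686 * (#B : ℝ) ^ 686 := mul_pow _ _ _
    _ ≤ q ^ 686 * (c * ((r * Real.logb 2 #A) ^ 173 * (#(A * A * A) : ℝ) ^ 166 *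
        (#(A + A) : ℝ) ^ 352)) := by
      refine mul_le_mul_of_nonneg_left ((h B hB hB0).trans ?_) (by positivity)
      gcongr
    _ = _ := by rw [mul_pow]; ring

lemma rpow_div_le_of_pow_le {c N s Z l C : ℝ} (hN : 1 ≤ N) (hs : N ≤ s) (hZ : 0 ≤ Z)
    (hc : 1 ≤ c) (hl : 3 / 2 ≤ l) (hC : Real.logb (3 / 2) c + 173 ≤ C * 166)
    (h : N ^ 686 ≤ c * (l ^ 173 * Z ^ 166 * s ^ 352)) :
    N ^ ((2 : ℝ) + 1 / 392) / ((s / N) ^ ((125 : ℝ) / 56) * l ^ C) ≤ Z := by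
  have hN0 : 0 < N := by linarith
  have hl0 : 0 < l := by linarith
  have hK : 1 ≤ s / N := (one_le_div hN0).2 hs
  have hK0 : 0 < s / N := by linarith
  rw [div_le_iff₀ (by positivity)]
  refine le_of_pow_le_pow_left₀ (n := 166) (by norm_num) (by positivity) ?_
  have e1 : (N ^ ((2 : ℝ) + 1 / 392)) ^ 166 ≤ N ^ 334 := by
    rw [← Real.rpow_mul_natCast hN0.le, ← Real.rpow_natCast N 334]
    exact Real.rpow_le_rpow_of_exponent_le hN (by norm_num)
  have e2 : (s / N) ^ 352 ≤ ((s / N) ^ ((125 : ℝ) / 56)) ^ 166 := by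
    rw [← Real.rpow_mul_natCast hK0.le, ← Real.rpow_natCast _ 352]
    exact Real.rpow_le_rpow_of_exponent_le hK (by norm_num)
  have e3 : c * l ^ 173 ≤ (l ^ C) ^ 166 := by
    rw [← Real.rpow_mul_natCast hl0.le]
    calc c * l ^ 173 = (3 / 2) ^ (Real.logb (3 / 2) c) * l ^ (173 : ℝ) := by
          rw [Real.rpow_logb (by norm_num) (by norm_num) (by linarith)]
          norm_cast
      _ ≤ l ^ (Real.logb (3 / 2) c) * l ^ (173 : ℝ) := by
          have := Real.logb_nonneg (b := 3 / 2) (by norm_num) hc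
          gcongr
      _ = l ^ (Real.logb (3 / 2) c + 173) := (Real.rpow_add hl0 _ _).symm
      _ ≤ _ := Real.rpow_le_rpow_of_exponent_le (by linarith) (by exact_mod_cast hC)
  have e4 : N ^ 334 ≤ Z ^ 166 * ((s / N) ^ 352 * (c * l ^ 173)) := by
    refine le_of_mul_le_mul_right ?_ (pow_pos hN0 352)
    calc N ^ 334 * N ^ 352 = N ^ 686 := (pow_add _ _ _).symm
      _ ≤ c * (l ^ 173 * Z ^ 166 * s ^ 352) := h
      _ = _ := by
        rw [div_pow]
        field_simp
  calc (N ^ ((2 : ℝ) + 1 / 392)) ^ 166 ≤ N ^ 334 := e1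
    _ ≤ Z ^ 166 * ((s / N) ^ 352 * (c * l ^ 173)) := e4
    _ ≤ Z ^ 166 * (((s / N) ^ ((125 : ℝ) / 56)) ^ 166 * (l ^ C) ^ 166) :=
        mul_le_mul_of_nonneg_left (mul_le_mul e2 e3 (by positivity) (by positivity))
          (pow_nonneg hZ _)
    _ = _ := by rw [mul_pow, mul_pow]

lemma rpow_div_le_two {s l C : ℝ} (hs : 3 ≤ s) (hl : l = 1) :
    (2 : ℝ) ^ ((2 : ℝ) + 1 / 392) / ((s / 2) ^ ((125 : ℝ) / 56) * l ^ C) ≤ 2 := by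
  subst hl
  rw [Real.one_rpow, mul_one, div_le_iff₀ (by positivity)]
  calc (2 : ℝ) ^ ((2 : ℝ) + 1 / 392) = 2 * (2 * 2 ^ (1 / 392 : ℝ)) := by
        rw [Real.rpow_add (by norm_num)]
        norm_num
        ring
    _ ≤ 2 * (2 * 2 ^ (1 / 8 : ℝ)) := by
        gcongr <;> norm_num
    _ ≤ 2 * (2 * (9 / 8)) := by
        gcongr
        rw [one_div, Real.rpow_inv_le_iff_of_pos] <;> norm_num
    _ = 2 * (3 / 2) ^ (2 : ℝ) := by norm_num
    _ ≤ 2 * (3 / 2) ^ ((125 : ℝ) / 56) := by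
        gcongr <;> norm_num
    _ ≤ _ := by gcongr

theorem stmt_5 :
    ∃ C : ℝ, 0 < C ∧ ∀ A : Finset ℝ,
      2 ≤ A.card →
      (A.card : ℝ) ^ ((2 : ℝ) + 1 / 392) /
          ((((A + A).card : ℝ) / (A.card : ℝ)) ^ ((125 : ℝ) / 56) *
            (Real.logb 2 (A.card : ℝ)) ^ C)
        ≤ ((A * A * A).card : ℝ) := by
  obtain ⟨c, hc, h⟩ := exists_card_pow_le
  have hc0 := Real.logb_nonneg (b := 3 / 2) (by norm_num) hc
  refine ⟨(Real.logb (3 / 2) c + 173) / 166, by positivity, fun A hA ↦ ?_⟩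
  have hne : A.Nonempty := card_pos.1 (by lia)
  rcases hA.eq_or_lt with h2 | h3
  · have hs : 3 ≤ #(A + A) := by
      have := cauchy_davenport_add_of_linearOrder_isCancelAdd hne hne
      lia
    have hZ : 2 ≤ #(A * A * A) := by
      obtain ⟨a, ha, ha0⟩ := exists_mem_ne (s := A) (by lia) (0 : ℝ)
      rw [h2]
      refine (card_le_card_mul_right_of_injective ha (mul_left_injective₀ ha0)).trans
        (card_le_card_mul_right_of_injective ha (mul_left_injective₀ ha0))
    rw [← h2]
    refine le_trans ?_ (by exact_mod_cast hZ : (2 : ℝ) ≤ #(A * A * A))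
    push_cast
    exact rpow_div_le_two (by exact_mod_cast hs) (by norm_num)
  · refine rpow_div_le_of_pow_le (by exact_mod_cast hne.card_pos) ?_ (by positivity) hc ?_
      (by linarith) (h A hA)
    · exact_mod_cast card_le_card_add_left hne
    · calc (3 / 2 : ℝ) ≤ Real.logb 2 3 := by
            rw [Real.le_logb_iff_rpow_le (by norm_num) (by norm_num)]
            refine le_of_pow_le_pow_left₀ two_ne_zero (by norm_num) ?_
            rw [← Real.rpow_mul_natCast (by norm_num)]
            norm_num
        _ ≤ _ := by
            gcongr
            · norm_num
            · exact_mod_cast h3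
end

section
/- Let A ⊆ ℝ be a finite nonempty set and write S := A+A. Then the number of quadruples (b, b′, c, c′) ∈ S × S × A × A satisfying b−c ∈ A, b−c′ ∈ A, b′−c ∈ A and b′−c′ ∈ A is at least |A|⁶ / |S|². -/
open Finset Pointwise

/-- The `C₄` case of Sidorenko's inequality for a weighted bipartite graph. -/
theorem sum_pow_four_le_card_sq_mul_sum_four_cycles {β γ : Type*} (s : Finset β) (t : Finset γ)
    (w : β → γ → ℝ) :
    (∑ b ∈ s, ∑ c ∈ t, w b c) ^ 4 ≤ (#s : ℝ) ^ 2 * (#t : ℝ) ^ 2 *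
      ∑ b ∈ s, ∑ b' ∈ s, ∑ c ∈ t, ∑ c' ∈ t, w b c * w b c' * (w b' c * w b' c') := by
  have paths : ∑ b ∈ s, (∑ c ∈ t, w b c) ^ 2
      = ∑ p ∈ t ×ˢ t, ∑ b ∈ s, w b p.1 * w b p.2 := by
    rw [sum_comm]
    refine sum_congr rfl fun b _ => ?_
    rw [sum_product, sq, sum_mul_sum]
  have cycles : ∑ b ∈ s, ∑ b' ∈ s, ∑ c ∈ t, ∑ c' ∈ t, w b c * w b c' * (w b' c * w b' c')
      = ∑ p ∈ t ×ˢ t, (∑ b ∈ s, w b p.1 * w b p.2) ^ 2 := by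
    simp_rw [sq, sum_mul_sum]
    rw [sum_comm (s := t ×ˢ t)]
    refine sum_congr rfl fun b _ => ?_
    rw [sum_comm (s := t ×ˢ t)]
    refine sum_congr rfl fun b' _ => ?_
    rw [sum_product]
  have h₁ := sq_sum_le_card_mul_sum_sq (s := s) (f := fun b => ∑ c ∈ t, w b c)
  have h₂ := sq_sum_le_card_mul_sum_sq (s := t ×ˢ t) (f := fun p => ∑ b ∈ s, w b p.1 * w b p.2)
  rw [← paths, ← cycles, card_product, Nat.cast_mul] at h₂
  calc (∑ b ∈ s, ∑ c ∈ t, w b c) ^ 4 = ((∑ b ∈ s, ∑ c ∈ t, w b c) ^ 2) ^ 2 := by ring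
    _ ≤ ((#s : ℝ) * ∑ b ∈ s, (∑ c ∈ t, w b c) ^ 2) ^ 2 := by gcongr
    _ = (#s : ℝ) ^ 2 * (∑ b ∈ s, (∑ c ∈ t, w b c) ^ 2) ^ 2 := by ring
    _ ≤ (#s : ℝ) ^ 2 * ((#t * #t : ℝ) *
        ∑ b ∈ s, ∑ b' ∈ s, ∑ c ∈ t, ∑ c' ∈ t, w b c * w b c' * (w b' c * w b' c')) := by gcongr
    _ = _ := by ring

/-- The pairs `(b, c)` with `b - c ∈ A` correspond to the pairs `(b - c, c) ∈ A × A`. -/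
theorem sum_indicator_sub_mem (A : Finset ℝ) :
    ∑ b ∈ A + A, ∑ c ∈ A, (if b - c ∈ A then 1 else 0 : ℝ) = (#A : ℝ) ^ 2 := by
  rw [sum_comm, sq, ← nsmul_eq_mul]
  refine sum_eq_card_nsmul fun c hc => ?_
  rw [sum_boole]
  congr 1
  refine card_bij' (fun b _ => b - c) (fun a _ => a + c) ?_ ?_ ?_ ?_
  · exact fun b hb => (mem_filter.1 hb).2
  · exact fun a ha => mem_filter.2 ⟨add_mem_add ha hc, by simpa using ha⟩
  · simp
  · simp

theorem stmt_8 (A : Finset ℝ) (hA : A.Nonempty) :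
    (A.card : ℝ) ^ 6 / ((A + A).card : ℝ) ^ 2
      ≤ (((((A + A) ×ˢ (A + A) ×ˢ A ×ˢ A).filter fun q =>
          q.1 - q.2.2.1 ∈ A ∧ q.1 - q.2.2.2 ∈ A ∧
          q.2.1 - q.2.2.1 ∈ A ∧ q.2.1 - q.2.2.2 ∈ A).card : ℝ)) := by
  have hApos : (0 : ℝ) < #A := by exact_mod_cast hA.card_pos
  have hSpos : (0 : ℝ) < #(A + A) := by exact_mod_cast (hA.add hA).card_pos
  have key := sum_pow_four_le_card_sq_mul_sum_four_cycles (A + A) A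
    fun b c => if b - c ∈ A then 1 else 0
  rw [sum_indicator_sub_mem] at key
  rw [← sum_boole, div_le_iff₀ (by positivity)]
  simp only [sum_product]
  have cycle_indicator : ∀ b b' c c' : ℝ,
      (if b - c ∈ A then 1 else 0 : ℝ) * (if b - c' ∈ A then 1 else 0) *
        ((if b' - c ∈ A then 1 else 0) * (if b' - c' ∈ A then 1 else 0)) =
      if b - c ∈ A ∧ b - c' ∈ A ∧ b' - c ∈ A ∧ b' - c' ∈ A then 1 else 0 := by
    intro b b' c c'
    by_cases h₁ : b - c ∈ A <;> by_cases h₂ : b - c' ∈ A <;> by_cases h₃ : b' - c ∈ A <;>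
      by_cases h₄ : b' - c' ∈ A <;> simp only [h₁, h₂, h₃, h₄] <;> norm_num
  simp only [cycle_indicator] at key
  refine le_of_mul_le_mul_left ?_ (pow_pos hApos 2)
  linarith only [key]
end

section
/- There exist absolute constants c > 0 and C > 0 such that for every finite set A ⊆ ℝ with |A| ≥ 2 and 0 ∉ A, the additive energy of the set AA/AA satisfies E⁺(AA/AA) ≥ c · |A|^19 / (|A+A|^14 · (log |A|)^C). -/
open Finset Pointwise

/-- The number of points of `A ×ˢ A` on the line through the origin with slope `l`. -/
noncomputable def slopeCount (A : Finset ℝ) (l : ℝ) : ℕ := (A.filter fun a => l * a ∈ A).card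

/-- The additive quadruples in `A`. -/
noncomputable def addQuads (A : Finset ℝ) : Finset (ℝ × ℝ × ℝ × ℝ) :=
  (A ×ˢ A ×ˢ A ×ˢ A).filter fun x => x.1 + x.2.1 = x.2.2.1 + x.2.2.2

theorem card_mul_sq_le_card_filter {A : Finset ℝ} (hA : ∀ a ∈ A, 0 < a) {k : ℕ} (hk : 0 < k)
    (L : Finset ℝ) (hL : ∀ l ∈ L, k ≤ slopeCount A l) :
    L.card * k ^ 2 ≤
      (((A + A) ×ˢ (A + A)).filter fun p => ∃ m ∈ L, p.2 ≤ m * p.1).card := by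
  induction L using Finset.induction_on_max with
  | empty => simp
  | insert u L hu ih =>
    have ih := ih fun l hl => hL l (mem_insert_of_mem hl)
    have huL : u ∉ L := fun h => (hu u h).false
    have hku := hL u (mem_insert_self _ _)
    rw [card_insert_of_notMem huL, add_mul, one_mul]
    rcases L.eq_empty_or_nonempty with rfl | hne
    · have hne : (A.filter fun a => u * a ∈ A).Nonempty := card_pos.1 (hk.trans_le hku)
      obtain ⟨c, hc, hmin⟩ := exists_min_image _ id hne
      simp only [mem_filter, id] at hc hmin
      have hu0 : 0 < u := pos_of_mul_pos_left (hA _ hc.2) (hA _ hc.1).le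
      simp only [card_empty, zero_mul, zero_add]
      calc k ^ 2 ≤ ((A.filter fun a => u * a ∈ A) ×ˢ (A.filter fun a => u * a ∈ A)).card := by
            rw [card_product, ← sq]; exact Nat.pow_le_pow_left hku 2
        _ ≤ _ := by
            refine card_le_card_of_injOn (fun p => (p.1 + p.2, u * p.1 + u * c)) ?_ ?_
            · rintro ⟨a, b⟩ h
              simp only [coe_product, Set.mem_prod, mem_coe, mem_filter] at h
              simp only [mem_coe, mem_filter, mem_product, mem_insert]
              refine ⟨⟨add_mem_add h.1.1 h.2.1, add_mem_add h.1.2 hc.2⟩, u, Or.inl rfl, ?_⟩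
              nlinarith [hmin b h.2]
            · rintro ⟨a, b⟩ _ ⟨a', b'⟩ _ h
              simp only [Prod.mk.injEq] at h
              have : a = a' := mul_left_cancel₀ hu0.ne' (by linarith [h.2])
              subst this
              simpa using h.1
    · set m := L.max' hne
      have hm : m ∈ L := L.max'_mem hne
      have hmu : m < u := hu m hm
      have hkm := hL m (mem_insert_of_mem hm)
      have hnew : k ^ 2 ≤ (((A + A) ×ˢ (A + A)).filter
          fun p => m * p.1 < p.2 ∧ p.2 ≤ u * p.1).card := by
        calc k ^ 2 ≤ ((A.filter fun a => m * a ∈ A) ×ˢ (A.filter fun a => u * a ∈ A)).card := by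
              rw [card_product, sq]; exact Nat.mul_le_mul hkm hku
          _ ≤ _ := by
              refine card_le_card_of_injOn (fun p => (p.1 + p.2, m * p.1 + u * p.2)) ?_ ?_
              · rintro ⟨a, b⟩ h
                simp only [coe_product, Set.mem_prod, mem_coe, mem_filter] at h
                simp only [mem_coe, mem_filter, mem_product]
                have ha := hA a h.1.1
                have hb := hA b h.2.1
                refine ⟨⟨add_mem_add h.1.1 h.2.1, add_mem_add h.1.2 h.2.2⟩, ?_, ?_⟩ <;> nlinarith
              · rintro ⟨a, b⟩ _ ⟨a', b'⟩ _ h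
                simp only [Prod.mk.injEq] at h
                have h2 : (u - m) * b = (u - m) * b' := by linear_combination h.2 - m * h.1
                have : b = b' := mul_left_cancel₀ (sub_pos.2 hmu).ne' h2
                subst this
                simpa using h.1
      refine (add_le_add ih hnew).trans ?_
      rw [← card_union_of_disjoint]
      · refine card_le_card fun p hp => ?_
        simp only [mem_union, mem_filter, mem_insert] at hp ⊢
        rcases hp with ⟨h, l, hl, hp⟩ | ⟨h, -, hp⟩
        · exact ⟨h, l, Or.inr hl, hp⟩
        · exact ⟨h, u, Or.inl rfl, hp⟩
      · rw [disjoint_filter]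
        rintro ⟨x, y⟩ hp ⟨l, hl, h1⟩ ⟨h2, -⟩
        obtain ⟨a, ha, b, hb, rfl⟩ := mem_add.1 (mem_product.1 hp).1
        have := L.le_max' l hl
        have hpos := add_pos (hA a ha) (hA b hb)
        have := mul_le_mul_of_nonneg_right this hpos.le
        exact absurd (h1.trans this) (not_le.2 h2)

/-- Solymosi's bound for the number of slopes that are hit at least `k` times. -/
theorem card_slopes_mul_sq_le_s10 {A : Finset ℝ} (hA : ∀ a ∈ A, 0 < a) {k : ℕ} (hk : 0 < k)
    (L : Finset ℝ) :
    (L.filter fun l => k ≤ slopeCount A l).card * k ^ 2 ≤ (A + A).card ^ 2 := by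
  refine (card_mul_sq_le_card_filter hA hk _ fun l hl => (mem_filter.1 hl).2).trans ?_
  refine (card_filter_le _ _).trans ?_
  rw [card_product, sq]

theorem slopeCount_le (A : Finset ℝ) (l : ℝ) : slopeCount A l ≤ A.card := card_filter_le _ _

theorem sum_sum_Icc_slopeCount (A L : Finset ℝ) (w : ℕ → ℝ) :
    ∑ l ∈ L, ∑ k ∈ Icc 1 (slopeCount A l), w k =
      ∑ k ∈ Icc 1 A.card, ((L.filter fun l => k ≤ slopeCount A l).card : ℝ) * w k := by
  simp_rw [← nsmul_eq_mul, ← sum_const]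
  refine sum_comm' fun l k => ?_
  have := slopeCount_le A l
  simp only [mem_Icc, mem_filter]
  grind

theorem sum_slopeCount_sq_le {A : Finset ℝ} (hA : ∀ a ∈ A, 0 < a) (L : Finset ℝ) :
    ∑ l ∈ L, (slopeCount A l : ℝ) ^ 2 ≤
      2 * ((A + A).card : ℝ) ^ 2 * (1 + Real.log A.card) := by
  have hsq (n : ℕ) : (n : ℝ) ^ 2 ≤ ∑ k ∈ Icc 1 n, 2 * (k : ℝ) := by
    induction n with
    | zero => simp
    | succ n ih => rw [sum_Icc_succ_top (by omega)]; push_cast; nlinarith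
  calc ∑ l ∈ L, (slopeCount A l : ℝ) ^ 2
      ≤ ∑ l ∈ L, ∑ k ∈ Icc 1 (slopeCount A l), 2 * (k : ℝ) := sum_le_sum fun l _ => hsq _
    _ = _ := sum_sum_Icc_slopeCount A L _
    _ ≤ ∑ k ∈ Icc 1 A.card, 2 * ((A + A).card : ℝ) ^ 2 * (k : ℝ)⁻¹ := by
        refine sum_le_sum fun k hk => ?_
        have hk1 := (mem_Icc.1 hk).1
        have hk0 : (0 : ℝ) < k := by exact_mod_cast hk1
        have h : ((L.filter fun l => k ≤ slopeCount A l).card : ℝ) * (k : ℝ) ^ 2 ≤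
          ((A + A).card : ℝ) ^ 2 := by exact_mod_cast card_slopes_mul_sq_le_s10 hA hk1 L
        rw [← div_eq_mul_inv, le_div_iff₀ hk0]
        linarith
    _ ≤ _ := by
        rw [← mul_sum]
        have h := harmonic_le_one_add_log A.card
        rw [harmonic_eq_sum_Icc] at h
        push_cast at h
        gcongr

theorem sum_slopeCount_cube_le {A : Finset ℝ} (hA : ∀ a ∈ A, 0 < a) (L : Finset ℝ) :
    ∑ l ∈ L, (slopeCount A l : ℝ) ^ 3 ≤ 3 * ((A + A).card : ℝ) ^ 2 * A.card := by
  have hcube (n : ℕ) : (n : ℝ) ^ 3 ≤ ∑ k ∈ Icc 1 n, 3 * (k : ℝ) ^ 2 := by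
    induction n with
    | zero => simp
    | succ n ih =>
      rw [sum_Icc_succ_top (by omega)]; push_cast
      have : (0 : ℝ) ≤ n := n.cast_nonneg
      nlinarith
  calc ∑ l ∈ L, (slopeCount A l : ℝ) ^ 3
      ≤ ∑ l ∈ L, ∑ k ∈ Icc 1 (slopeCount A l), 3 * (k : ℝ) ^ 2 := sum_le_sum fun l _ => hcube _
    _ = _ := sum_sum_Icc_slopeCount A L _
    _ ≤ ∑ k ∈ Icc 1 A.card, 3 * ((A + A).card : ℝ) ^ 2 := by
        refine sum_le_sum fun k hk => ?_
        have h : ((L.filter fun l => k ≤ slopeCount A l).card : ℝ) * (k : ℝ) ^ 2 ≤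
          ((A + A).card : ℝ) ^ 2 := by
            exact_mod_cast card_slopes_mul_sq_le_s10 hA (mem_Icc.1 hk).1 L
        linarith
    _ = _ := by simp; ring

theorem card_pow_four_le_card_div_mul {A : Finset ℝ} (hA : ∀ a ∈ A, 0 < a) :
    (A.card : ℝ) ^ 4 ≤ (A / A).card * ∑ l ∈ A / A, (slopeCount A l : ℝ) ^ 2 := by
  have h : A.card ^ 2 = ∑ l ∈ A / A, slopeCount A l := by
    rw [sq, ← card_product, card_eq_sum_card_fiberwise (f := fun p : ℝ × ℝ => p.2 / p.1)
      (t := A / A) fun p hp => ?_]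
    · refine sum_congr rfl fun l _ => card_nbij' (fun p => p.1) (fun a => (a, l * a)) ?_ ?_ ?_ ?_
      · rintro ⟨a, b⟩ h
        have := hA a
        grind
      · intro a h
        have := hA a
        grind
      · rintro ⟨a, b⟩ h
        have := hA a
        grind
      · intro a _
        rfl
    · simp only [coe_product, Set.mem_prod, mem_coe] at hp
      exact div_mem_div hp.2 hp.1
  have h' : (A.card : ℝ) ^ 2 = ∑ l ∈ A / A, (slopeCount A l : ℝ) := by exact_mod_cast h
  calc (A.card : ℝ) ^ 4 = (∑ l ∈ A / A, (slopeCount A l : ℝ)) ^ 2 := by rw [← h']; ring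
    _ ≤ _ := sq_sum_le_card_mul_sum_sq

theorem card_sq_le_card_image_mul {α β : Type*} [DecidableEq α] [DecidableEq β]
    (s : Finset α) (f : α → β) :
    s.card ^ 2 ≤ (s.image f).card * ((s ×ˢ s).filter fun p => f p.1 = f p.2).card := by
  have h : ((s ×ˢ s).filter fun p => f p.1 = f p.2).card =
      ∑ b ∈ s.image f, (s.filter fun a => f a = b).card ^ 2 := by
    rw [card_eq_sum_card_fiberwise (f := fun p : α × α => f p.1) (t := s.image f)]
    · refine sum_congr rfl fun b _ => ?_
      rw [sq, ← card_product]
      congr 1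
      ext ⟨x, y⟩
      grind
    · rintro ⟨x, y⟩ h
      grind
  rw [h, card_eq_sum_card_image f s]
  exact sq_sum_le_card_mul_sum_sq

theorem card_pow_four_le_card_add_mul (A : Finset ℝ) :
    A.card ^ 4 ≤ (A + A).card * (addQuads A).card := by
  have h := card_sq_le_card_image_mul (A ×ˢ A) fun p => p.1 + p.2
  rw [card_product] at h
  calc A.card ^ 4 = (A.card * A.card) ^ 2 := by ring
    _ ≤ _ := h
    _ ≤ _ := by
      refine Nat.mul_le_mul ?_ ?_
      · refine card_le_card fun x hx => ?_
        obtain ⟨p, hp, rfl⟩ := mem_image.1 hx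
        exact add_mem_add (mem_product.1 hp).1 (mem_product.1 hp).2
      · refine card_le_card_of_injOn (fun p => (p.1.1, p.1.2, p.2.1, p.2.2)) ?_ ?_
        · rintro ⟨⟨a, b⟩, c, d⟩ h
          simp [addQuads] at h ⊢
          grind
        · rintro ⟨⟨a, b⟩, c, d⟩ _ ⟨⟨a', b'⟩, c', d'⟩ _ h
          grind

/-- The point of projective space spanned by a quadruple, in affine coordinates. -/
noncomputable def direction (x : ℝ × ℝ × ℝ × ℝ) : ℝ × ℝ × ℝ :=
  (x.2.1 / x.1, x.2.2.1 / x.1, x.2.2.2 / x.1)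

theorem card_parallel_addQuads_le {A : Finset ℝ} (hA : ∀ a ∈ A, 0 < a) :
    ((addQuads A ×ˢ addQuads A).filter fun p => direction p.1 = direction p.2).card ≤
      ∑ l ∈ A / A, slopeCount A l ^ 3 := by
  have hsum : ∑ l ∈ A / A, slopeCount A l ^ 3 = ((A / A).sigma fun l =>
      (A.filter fun a => l * a ∈ A) ×ˢ (A.filter fun a => l * a ∈ A) ×ˢ
        (A.filter fun a => l * a ∈ A)).card := by
    rw [card_sigma]
    refine sum_congr rfl fun l _ => ?_
    simp only [card_product, slopeCount]
    ring
  have hscale : ∀ a a' b b' : ℝ, 0 < a → 0 < a' → b / a = b' / a' → a' / a * b = b' := by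
    intro a a' b b' ha ha' h
    field_simp at h ⊢
    linarith
  rw [hsum]
  refine card_le_card_of_injOn (fun p => ⟨p.2.1 / p.1.1, p.1.1, p.1.2.1, p.1.2.2.1⟩) ?_ ?_
  · rintro ⟨⟨a, b, c, d⟩, a', b', c', d'⟩ h
    simp only [addQuads, direction, coe_filter, mem_product, mem_filter, Set.mem_ofPred_eq,
      Prod.mk.injEq] at h
    obtain ⟨⟨⟨⟨ha, hb, hc, hd⟩, hs⟩, ⟨ha', hb', hc', hd'⟩, hs'⟩, h1, h2, h3⟩ := h
    have pa := hA a ha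
    have pa' := hA a' ha'
    simp only [coe_sigma, Set.mem_sigma_iff, mem_coe, mem_product, mem_filter]
    refine ⟨div_mem_div ha' ha, ⟨ha, ?_⟩, ⟨hb, ?_⟩, hc, ?_⟩
    · rwa [div_mul_cancel₀ _ pa.ne']
    · rwa [hscale a a' b b' pa pa' h1]
    · rwa [hscale a a' c c' pa pa' h2]
  · rintro ⟨⟨a, b, c, d⟩, a', b', c', d'⟩ h ⟨⟨e, f, g, i⟩, e', f', g', i'⟩ h' heq
    simp only [addQuads, direction, coe_filter, mem_product, mem_filter, Set.mem_ofPred_eq,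
      Prod.mk.injEq] at h h'
    obtain ⟨⟨⟨⟨ha, hb, hc, hd⟩, hs⟩, ⟨ha', hb', hc', hd'⟩, hs'⟩, h1, h2, h3⟩ := h
    obtain ⟨⟨⟨⟨he, hf, hg, hi⟩, ht⟩, ⟨he', hf', hg', hi'⟩, ht'⟩, k1, k2, k3⟩ := h'
    simp only [Sigma.mk.injEq, heq_eq_eq, Prod.mk.injEq] at heq
    obtain ⟨hl, rfl, rfl, rfl⟩ := heq
    have pa := hA a ha
    have pa' := hA a' ha'
    have pe' := hA e' he'
    obtain rfl : d = i := by linarith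
    obtain rfl : a' = e' := by field_simp at hl; exact hl
    rw [h1, div_left_inj' pa'.ne'] at k1
    rw [h2, div_left_inj' pa'.ne'] at k2
    rw [h3, div_left_inj' pa'.ne'] at k3
    simp [k1, k2, k3]

theorem card_div_mul_card_direction_le {A : Finset ℝ} (hA : ∀ a ∈ A, 0 < a) :
    (A / A).card * ((addQuads A).image direction).card ≤
      (addQuads (A * A / (A * A))).card := by
  rw [← card_product]
  have hmem : ∀ a b c d : ℝ, a ∈ A → b ∈ A → c ∈ A → d ∈ A →
      a / b * (c / d) ∈ A * A / (A * A) := by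
    intro a b c d ha hb hc hd
    rw [div_mul_div_comm]
    exact div_mem_div (mul_mem_mul ha hc) (mul_mem_mul hb hd)
  refine card_le_card_of_injOn
    (fun p => (p.1, p.1 * p.2.1, p.1 * p.2.2.1, p.1 * p.2.2.2)) ?_ ?_
  · rintro ⟨t, x⟩ h
    simp only [coe_product, Set.mem_prod, mem_coe, mem_image] at h
    obtain ⟨ht, ⟨a, b, c, d⟩, hq, rfl⟩ := h
    obtain ⟨u, hu, v, hv, rfl⟩ := mem_div.1 ht
    simp only [addQuads, mem_filter, mem_product] at hq
    obtain ⟨⟨ha, hb, hc, hd⟩, hs⟩ := hq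
    have pa := hA a ha
    simp only [addQuads, direction, mem_coe, mem_filter, mem_product]
    refine ⟨⟨?_, hmem _ _ _ _ hu hv hb ha, hmem _ _ _ _ hu hv hc ha,
      hmem _ _ _ _ hu hv hd ha⟩, ?_⟩
    · simpa [pa.ne'] using hmem u v a a hu hv ha ha
    · rw [← mul_add, ← add_div, ← hs, add_div, div_self pa.ne']
      ring
  · rintro ⟨t, x, y, z⟩ h ⟨t', x', y', z'⟩ _ heq
    simp only [coe_product, Set.mem_prod, mem_coe] at h
    obtain ⟨u, hu, v, hv, rfl⟩ := mem_div.1 h.1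
    have : u / v ≠ 0 := (div_pos (hA u hu) (hA v hv)).ne'
    simp only [Prod.mk.injEq] at heq ⊢
    obtain ⟨rfl, h1, h2, h3⟩ := heq
    exact ⟨rfl, mul_left_cancel₀ this h1, mul_left_cancel₀ this h2, mul_left_cancel₀ this h3⟩

theorem card_pow_eleven_le_of_pos {A : Finset ℝ} (hA : ∀ a ∈ A, 0 < a) (hne : A.Nonempty) :
    (A.card : ℝ) ^ 11 ≤ 6 * ((A + A).card : ℝ) ^ 6 * (1 + Real.log A.card) *
      (addQuads (A * A / (A * A))).card := by
  have hn : (1 : ℝ) ≤ A.card := by exact_mod_cast hne.card_pos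
  have hlog : 0 ≤ Real.log A.card := Real.log_nonneg hn
  have h2 : (A.card : ℝ) ^ 4 ≤ (A + A).card * (addQuads A).card := by
    exact_mod_cast card_pow_four_le_card_add_mul A
  have hc : ((addQuads A).card : ℝ) ^ 2 ≤ ((addQuads A).image direction).card *
      ((addQuads A ×ˢ addQuads A).filter fun p => direction p.1 = direction p.2).card := by
    exact_mod_cast card_sq_le_card_image_mul (addQuads A) direction
  have h4 : ((A / A).card : ℝ) * ((addQuads A).image direction).card ≤
      (addQuads (A * A / (A * A))).card := by
    exact_mod_cast card_div_mul_card_direction_le hA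
  set n : ℝ := (A.card : ℝ)
  set q : ℝ := ((A + A).card : ℝ)
  set E : ℝ := ((addQuads (A * A / (A * A))).card : ℝ)
  set s : ℝ := ((addQuads A).card : ℝ)
  set D : ℝ := (((addQuads A).image direction).card : ℝ)
  set R : ℝ := ((A / A).card : ℝ)
  have h1 : n ^ 4 ≤ R * (2 * q ^ 2 * (1 + Real.log n)) :=
    (card_pow_four_le_card_div_mul hA).trans
      (mul_le_mul_of_nonneg_left (sum_slopeCount_sq_le hA _) (Nat.cast_nonneg _))
  have h3 : s ^ 2 ≤ D * (3 * q ^ 2 * n) := by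
    have hp : (((addQuads A ×ˢ addQuads A).filter
        fun p => direction p.1 = direction p.2).card : ℝ) ≤ 3 * q ^ 2 * n := by
      refine le_trans ?_ (sum_slopeCount_cube_le hA (A / A))
      exact_mod_cast card_parallel_addQuads_le hA
    exact hc.trans (mul_le_mul_of_nonneg_left hp (Nat.cast_nonneg _))
  have h5 : n ^ 8 ≤ q ^ 2 * (D * (3 * q ^ 2 * n)) :=
    calc n ^ 8 = (n ^ 4) ^ 2 := by ring
      _ ≤ (q * s) ^ 2 := by gcongr
      _ = q ^ 2 * s ^ 2 := by ring
      _ ≤ _ := by gcongr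
  have hn0 : 0 < n := by linarith
  refine le_of_mul_le_mul_right ?_ hn0
  calc n ^ 11 * n = n ^ 4 * n ^ 8 := by ring
    _ ≤ (R * (2 * q ^ 2 * (1 + Real.log n))) * (q ^ 2 * (D * (3 * q ^ 2 * n))) := by gcongr
    _ = 6 * q ^ 6 * (1 + Real.log n) * (R * D) * n := by ring
    _ ≤ _ := by gcongr

theorem addQuads_mono {A B : Finset ℝ} (h : A ⊆ B) : addQuads A ⊆ addQuads B :=
  filter_subset_filter _
    (product_subset_product h (product_subset_product h (product_subset_product h h)))

theorem exists_pos_half {A : Finset ℝ} (h0 : (0 : ℝ) ∉ A) :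
    ∃ B : Finset ℝ, (∀ b ∈ B, 0 < b) ∧ A.card ≤ 2 * B.card ∧ B.card ≤ A.card ∧
      (B + B).card ≤ (A + A).card ∧ B * B ⊆ A * A := by
  have hsplit := card_filter_add_card_filter_not (s := A) (fun a => 0 < a)
  rcases le_total (A.filter fun a => ¬ 0 < a).card (A.filter fun a => 0 < a).card with h | h
  · have hs : (A.filter fun a => 0 < a) ⊆ A := filter_subset _ _
    exact ⟨A.filter fun a => 0 < a, fun b hb => (mem_filter.1 hb).2, by omega, card_le_card hs,
      card_le_card (add_subset_add hs hs), mul_subset_mul hs hs⟩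
  · have hs : (A.filter fun a => ¬ 0 < a) ⊆ A := filter_subset _ _
    refine ⟨-(A.filter fun a => ¬ 0 < a), fun b hb => ?_, ?_, ?_, ?_, ?_⟩
    · rw [Finset.mem_neg'] at hb
      obtain ⟨hb, hb'⟩ := mem_filter.1 hb
      have : -b ≠ 0 := fun h => h0 (h ▸ hb)
      have := lt_of_le_of_ne (not_lt.1 hb') this
      linarith
    · rw [card_neg]; omega
    · rw [card_neg]; exact card_le_card hs
    · rw [← neg_add_rev, card_neg]; exact card_le_card (add_subset_add hs hs)
    · intro x hx
      obtain ⟨a, ha, b, hb, rfl⟩ := mem_mul.1 hx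
      rw [Finset.mem_neg'] at ha hb
      rw [← neg_mul_neg a b]
      exact mul_mem_mul (hs ha) (hs hb)

theorem stmt_10 :
    ∃ c C : ℝ, 0 < c ∧ 0 < C ∧ ∀ A : Finset ℝ,
      2 ≤ A.card → (0 : ℝ) ∉ A →
      c * (A.card : ℝ) ^ (19 : ℕ) /
          (((A + A).card : ℝ) ^ (14 : ℕ) * (Real.logb 2 (A.card : ℝ)) ^ C)
        ≤ (((((A * A / (A * A)) ×ˢ (A * A / (A * A)) ×ˢ
              (A * A / (A * A)) ×ˢ (A * A / (A * A))).filter fun x =>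
            x.1 + x.2.1 = x.2.2.1 + x.2.2.2).card : ℝ)) := by
  refine ⟨1 / (12 * 2 ^ 11), 1, by norm_num, one_pos, fun A hA h0 => ?_⟩
  obtain ⟨B, hpos, hAB, hBA, hadd, hmul⟩ := exists_pos_half h0
  have hBne : B.Nonempty := card_pos.1 (by omega)
  have key := card_pow_eleven_le_of_pos hpos hBne
  have hE : (addQuads (B * B / (B * B))).card ≤ (addQuads (A * A / (A * A))).card :=
    card_le_card (addQuads_mono (div_subset_div hmul hmul))
  have hAq : A.card ≤ (A + A).card := card_le_card_add_left (card_pos.1 (by omega))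
  change _ ≤ ((addQuads (A * A / (A * A))).card : ℝ)
  rw [Real.rpow_one]
  have hA' : (2 : ℝ) ≤ A.card := by exact_mod_cast hA
  have hAB' : (A.card : ℝ) ≤ 2 * B.card := by exact_mod_cast hAB
  have hBA' : (B.card : ℝ) ≤ A.card := by exact_mod_cast hBA
  have hadd' : ((B + B).card : ℝ) ≤ (A + A).card := by exact_mod_cast hadd
  have hE' : ((addQuads (B * B / (B * B))).card : ℝ) ≤ (addQuads (A * A / (A * A))).card := by
    exact_mod_cast hE
  have hAq' : (A.card : ℝ) ≤ (A + A).card := by exact_mod_cast hAq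
  have hB0 : (0 : ℝ) < B.card := by exact_mod_cast hBne.card_pos
  have hl1 : 1 ≤ Real.logb 2 A.card := by
    rw [Real.le_logb_iff_rpow_le (by norm_num) (by linarith)]
    simpa using hA'
  have hl2 : Real.log B.card ≤ Real.logb 2 A.card := by
    refine (Real.log_le_log hB0 hBA').trans ?_
    rw [Real.logb, le_div_iff₀ (Real.log_pos (by norm_num))]
    have := Real.log_two_lt_d9
    nlinarith [Real.log_nonneg (by linarith : (1 : ℝ) ≤ A.card)]
  have hl0 : 0 ≤ Real.log B.card :=
    Real.log_nonneg (by exact_mod_cast hBne.card_pos)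
  have hE0 : (0 : ℝ) ≤ (addQuads (B * B / (B * B))).card := Nat.cast_nonneg _
  have hq0 : (0 : ℝ) ≤ (B + B).card := Nat.cast_nonneg _
  generalize Real.log (B.card : ℝ) = lB at *
  generalize Real.logb 2 (A.card : ℝ) = l at *
  generalize ((addQuads (A * A / (A * A))).card : ℝ) = E at *
  generalize ((addQuads (B * B / (B * B))).card : ℝ) = E' at *
  generalize ((A + A).card : ℝ) = Q at *
  generalize ((B + B).card : ℝ) = q at *
  generalize (A.card : ℝ) = n at *
  generalize (B.card : ℝ) = b at *
  have hl : 0 < l := by linarith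
  have hQ : 0 < Q := by linarith
  rw [div_le_iff₀ (by positivity)]
  have hmain : n ^ 19 ≤ 12 * 2 ^ 11 * (E * (Q ^ 14 * l)) :=
    calc n ^ 19 = n ^ 11 * n ^ 8 := by ring
      _ ≤ (2 * b) ^ 11 * Q ^ 8 := by gcongr
      _ = 2 ^ 11 * b ^ 11 * Q ^ 8 := by ring
      _ ≤ 2 ^ 11 * (6 * q ^ 6 * (1 + lB) * E') * Q ^ 8 := by gcongr
      _ ≤ 2 ^ 11 * (6 * Q ^ 6 * (l + l) * E) * Q ^ 8 := by gcongr
      _ = _ := by ring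
  linarith
end

section
/- There exist absolute constants c > 0 and C > 0 such that for every finite set A ⊆ ℝ with |A| ≥ 2, writing S := A+A and assuming 0 ∉ S, the additive energy of SS/SS satisfies E⁺(SS/SS) ≥ c · |A|⁵ / (log |A|)^C. -/
open Finset Pointwise

/-- The index of the block containing `x` when `X` is cut, in increasing order, into consecutive
blocks of `w` elements. -/
noncomputable def blockIndex (X : Finset ℝ) (w : ℕ) (x : ℝ) : ℕ := #{y ∈ X | y < x} / w

lemma blockIndex_mono (X : Finset ℝ) (w : ℕ) : Monotone (blockIndex X w) := fun _ _ h =>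
  Nat.div_le_div_right (card_le_card (monotone_filter_right X fun _ _ hz => lt_of_lt_of_le hz h))

lemma blockIndex_le (X : Finset ℝ) (w : ℕ) (x : ℝ) : blockIndex X w x ≤ #X / w :=
  Nat.div_le_div_right (card_filter_le _ _)

lemma card_block_le (X : Finset ℝ) {w : ℕ} (hw : 0 < w) (i : ℕ) :
    #{x ∈ X | blockIndex X w x = i} ≤ w := by
  have hmaps : ∀ x ∈ {x ∈ X | blockIndex X w x = i},
      #{y ∈ X | y < x} ∈ Ico (i * w) (i * w + w) := by
    intro x hx
    rw [mem_filter, blockIndex, Nat.div_eq_iff hw] at hx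
    rw [mem_Ico]
    omega
  have hinj : Set.InjOn (fun x : ℝ => #{y ∈ X | y < x})
      ({x ∈ X | blockIndex X w x = i} : Finset ℝ) := by
    have hlt : ∀ x ∈ X, ∀ x' : ℝ, x < x' → #{y ∈ X | y < x} < #{y ∈ X | y < x'} := by
      intro x hx x' h
      refine card_lt_card ⟨monotone_filter_right X fun _ _ hz => lt_trans hz h, fun hsub => ?_⟩
      exact lt_irrefl x (mem_filter.1 (hsub (mem_filter.2 ⟨hx, h⟩))).2
    intro x hx x' hx' heq
    rw [mem_coe, mem_filter] at hx hx'
    rcases lt_trichotomy x x' with h | h | h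
    · exact absurd heq (hlt x hx.1 x' h).ne
    · exact h
    · exact absurd heq (hlt x' hx'.1 x h).ne'
  simpa using card_le_card_of_injOn _ hmaps hinj

/-- Cauchy–Schwarz: lower bound for the number of collisions of `f` on `s`. -/
lemma card_sq_le_mul_card_collisions {α β : Type*} [DecidableEq β]
    (s : Finset α) (f : α → β) {t : Finset β} (hf : ∀ a ∈ s, f a ∈ t) :
    #s ^ 2 ≤ #t * #{p ∈ s ×ˢ s | f p.1 = f p.2} := by
  have hcoll : #{p ∈ s ×ˢ s | f p.1 = f p.2} = ∑ b ∈ t, #{a ∈ s | f a = b} ^ 2 := by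
    rw [card_eq_sum_card_fiberwise (f := fun p : α × α => f p.1) (t := t)
      fun p hp => hf _ (mem_product.1 (mem_filter.1 hp).1).1]
    refine sum_congr rfl fun b _ => ?_
    rw [sq, ← card_product]
    congr 1
    ext ⟨p, q⟩
    simp only [mem_filter, mem_product]
    grind
  rw [hcoll, card_eq_sum_card_fiberwise hf]
  exact sq_sum_le_card_mul_sum_sq

/-- The points of `X × X` on the line with slope `l.1` and intercept `l.2`. -/
noncomputable def gridLine (X : Finset ℝ) (l : ℝ × ℝ) : Finset (ℝ × ℝ) :=
  {p ∈ X ×ˢ X | p.2 = l.1 * p.1 + l.2}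

/-- The ordered pairs of distinct points of `P` which lie in the same `w × w` cell of `X × X`. -/
noncomputable def closePairs (X : Finset ℝ) (w : ℕ) (P : Finset (ℝ × ℝ)) :
    Finset ((ℝ × ℝ) × (ℝ × ℝ)) :=
  {p ∈ P.offDiag | blockIndex X w p.1.1 = blockIndex X w p.2.1 ∧
    blockIndex X w p.1.2 = blockIndex X w p.2.2}

lemma card_gridLine_sq_le (X : Finset ℝ) (w : ℕ) (l : ℝ × ℝ) :
    #(gridLine X l) ^ 2 ≤
      2 * (#X / w + 1) * (#(closePairs X w (gridLine X l)) + #(gridLine X l)) := by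
  set K := #X / w with hK
  set φ : ℝ × ℝ → ℕ := fun p => blockIndex X w p.1 +
    if 0 < l.1 then blockIndex X w p.2 else K - blockIndex X w p.2 with hφ
  have hle := blockIndex_le X w
  have hcs := card_sq_le_mul_card_collisions (gridLine X l) φ (t := range (2 * (K + 1))) (by
    intro p _
    have h1 := hle p.1
    have h2 := hle p.2
    simp only [hφ, mem_range]
    split_ifs <;> omega)
  rw [card_range] at hcs
  refine hcs.trans (Nat.mul_le_mul_left _ ?_)
  rw [← diag_card (gridLine X l)]
  refine (card_le_card ?_).trans (card_union_le _ _)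
  rintro ⟨p, q⟩ hpq
  simp only [mem_filter, mem_product] at hpq
  obtain ⟨⟨hp, hq⟩, heq⟩ := hpq
  rw [mem_union]
  by_cases hne : p = q
  · exact Or.inr (mem_diag.2 ⟨hp, hne⟩)
  refine Or.inl (mem_filter.2 ⟨mem_offDiag.2 ⟨hp, hq, hne⟩, ?_⟩)
  have hp2 := (mem_filter.1 hp).2
  have hq2 := (mem_filter.1 hq).2
  have hmono := blockIndex_mono X w
  have h1 := hle p.2
  have h2 := hle q.2
  simp only [hφ] at heq
  dsimp only
  rcases le_total p.1 q.1 with h | h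
  · have hx := hmono h
    split_ifs at heq with hpos
    · have := @hmono p.2 q.2 (by rw [hp2, hq2]; nlinarith)
      omega
    · have := @hmono q.2 p.2 (by rw [hp2, hq2]; nlinarith)
      omega
  · have hx := hmono h
    split_ifs at heq with hpos
    · have := @hmono q.2 p.2 (by rw [hp2, hq2]; nlinarith)
      omega
    · have := @hmono p.2 q.2 (by rw [hp2, hq2]; nlinarith)
      omega

lemma card_closePairs_grid_le (X : Finset ℝ) {w : ℕ} (hw : 0 < w) :
    #(closePairs X w (X ×ˢ X)) ≤ #X ^ 2 * w ^ 2 := by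
  have hsub : closePairs X w (X ×ˢ X) ⊆ (X ×ˢ X).biUnion fun p =>
      ({p} : Finset (ℝ × ℝ)) ×ˢ ({x ∈ X | blockIndex X w x = blockIndex X w p.1} ×ˢ
        {x ∈ X | blockIndex X w x = blockIndex X w p.2}) := by
    rintro ⟨p, q⟩ h
    simp only [closePairs, mem_filter, mem_offDiag, mem_product] at h
    simp only [mem_biUnion, mem_product, mem_singleton, mem_filter]
    exact ⟨p, h.1.1, rfl, ⟨h.1.2.1.1, h.2.1.symm⟩, h.1.2.1.2, h.2.2.symm⟩
  refine (card_le_card hsub).trans ((card_biUnion_le_card_mul _ _ (w ^ 2) fun p _ => ?_).trans ?_)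
  · rw [card_product, card_product, card_singleton, one_mul, sq]
    exact Nat.mul_le_mul (card_block_le X hw _) (card_block_le X hw _)
  · rw [card_product, sq (#X)]

lemma sum_card_closePairs_gridLine_le (X : Finset ℝ) (w : ℕ) (L : Finset (ℝ × ℝ)) :
    ∑ l ∈ L, #(closePairs X w (gridLine X l)) ≤ #(closePairs X w (X ×ˢ X)) := by
  rw [← card_biUnion]
  · refine card_le_card (biUnion_subset.2 fun l _ p hp => ?_)
    simp only [closePairs, gridLine, mem_filter, mem_offDiag] at hp ⊢
    exact ⟨⟨hp.1.1.1, hp.1.2.1.1, hp.1.2.2⟩, hp.2⟩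
  · intro l _ l' _ hne
    refine disjoint_left.2 ?_
    rintro ⟨p, q⟩ h h'
    simp only [closePairs, gridLine, mem_filter, mem_offDiag] at h h'
    obtain ⟨⟨⟨-, hp⟩, ⟨-, hq⟩, hpq⟩, -⟩ := h
    obtain ⟨⟨⟨-, hp'⟩, ⟨-, hq'⟩, -⟩, -⟩ := h'
    have hx : p.1 - q.1 ≠ 0 := fun h0 => hpq (by
      have h1 : p.1 = q.1 := sub_eq_zero.1 h0
      exact Prod.ext h1 (by rw [hp, hq, h1]))
    have hm : l.1 = l'.1 := mul_right_cancel₀ hx (by linarith)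
    exact hne (Prod.ext hm (by rw [hm] at hp; linarith))

lemma card_gridLine_cube_le (X : Finset ℝ) {l : ℝ × ℝ}
    (h2 : 2 ≤ #(gridLine X l)) :
    #(gridLine X l) ^ 3 ≤ ∑ j ∈ range (Nat.log 2 #X + 2),
      64 * (#X / 2 ^ j + 1) ^ 2 * #(closePairs X (2 ^ j) (gridLine X l)) := by
  set r := #(gridLine X l) with hr
  set J := Nat.log 2 #X + 1 with hJ
  have hJlt : #X < 2 ^ J := Nat.lt_pow_succ_log_self one_lt_two _
  have hrX : r ≤ #X := by
    refine card_le_card_of_injOn Prod.fst (fun p hp => (mem_product.1 (mem_filter.1 hp).1).1) ?_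
    intro p hp q hq h
    have hp2 := (mem_filter.1 hp).2
    have hq2 := (mem_filter.1 hq).2
    exact Prod.ext h (by rw [hp2, hq2, h])
  suffices ∃ j ∈ range (J + 1),
      r ^ 3 ≤ 64 * (#X / 2 ^ j + 1) ^ 2 * #(closePairs X (2 ^ j) (gridLine X l)) by
    obtain ⟨j, hj, h⟩ := this
    exact h.trans (single_le_sum (f := fun j => 64 * (#X / 2 ^ j + 1) ^ 2 *
      #(closePairs X (2 ^ j) (gridLine X l))) (fun _ _ => Nat.zero_le _) hj)
  by_cases hr4 : 4 ≤ r
  · have hex : ∃ j, 4 * (#X / 2 ^ j + 1) ≤ r := ⟨J, by rw [Nat.div_eq_of_lt hJlt]; omega⟩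
    classical
    have hspec := Nat.find_spec hex
    have hmin := fun i hi => Nat.find_min hex (m := i) hi
    have hfJ : Nat.find hex ≤ J := Nat.find_min' hex (by rw [Nat.div_eq_of_lt hJlt]; omega)
    generalize Nat.find hex = j at hspec hmin hfJ
    refine ⟨j, mem_range.2 (by omega), ?_⟩
    have hsq := card_gridLine_sq_le X (2 ^ j) l
    rw [← hr] at hsq
    obtain _ | i := j
    · simp at hspec
      omega
    have hi := hmin i (Nat.lt_succ_self i)
    have hdiv : #X / 2 ^ (i + 1) = #X / 2 ^ i / 2 := by rw [pow_succ, Nat.div_div_eq_div_mul]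
    have hr8 : r ≤ 8 * (#X / 2 ^ (i + 1) + 1) := by omega
    generalize #X / 2 ^ (i + 1) + 1 = K at *
    generalize #(closePairs X (2 ^ (i + 1)) (gridLine X l)) = c at *
    have h4 : r ^ 2 ≤ 4 * K * c := by nlinarith
    calc r ^ 3 = r * r ^ 2 := by ring
      _ ≤ (8 * K) * (4 * K * c) := Nat.mul_le_mul hr8 h4
      _ ≤ 64 * K ^ 2 * c := by nlinarith [Nat.zero_le (K ^ 2 * c)]
  · refine ⟨J, mem_range.2 (by omega), ?_⟩
    have hzero : ∀ x, blockIndex X (2 ^ J) x = 0 := fun x =>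
      Nat.le_zero.1 ((blockIndex_le X _ x).trans_eq (Nat.div_eq_of_lt hJlt))
    have hall : closePairs X (2 ^ J) (gridLine X l) = (gridLine X l).offDiag := by
      simp [closePairs, hzero]
    rw [hall, offDiag_card, ← hr, Nat.div_eq_of_lt hJlt]
    interval_cases r <;> norm_num

/-- Szemerédi–Trotter type bound for collinear triples in a Cartesian product `X × X`. -/
lemma sum_card_gridLine_cube_le (X : Finset ℝ) (hX : X.Nonempty) (L : Finset (ℝ × ℝ))
    (hL : ∀ l ∈ L, 2 ≤ #(gridLine X l)) :
    ∑ l ∈ L, #(gridLine X l) ^ 3 ≤ 576 * #X ^ 4 * (Nat.log 2 #X + 2) := by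
  refine (sum_le_sum fun l hl => card_gridLine_cube_le X (hL l hl)).trans ?_
  rw [sum_comm]
  refine (sum_le_card_nsmul _ _ (576 * #X ^ 4) fun j hj => ?_).trans_eq ?_
  · rw [← mul_sum]
    have hpairs := (sum_card_closePairs_gridLine_le X (2 ^ j) L).trans
      (card_closePairs_grid_le X (pow_pos two_pos j))
    have hw : 2 ^ j ≤ 2 * #X := by
      calc 2 ^ j ≤ 2 ^ (Nat.log 2 #X + 1) :=
            Nat.pow_le_pow_right two_pos (by rw [mem_range] at hj; omega)
        _ = 2 * 2 ^ Nat.log 2 #X := by ring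
        _ ≤ 2 * #X := Nat.mul_le_mul_left _ (Nat.pow_log_le_self 2 hX.card_pos.ne')
    have hK : (#X / 2 ^ j + 1) * 2 ^ j ≤ 3 * #X := by
      have := Nat.div_mul_le_self #X (2 ^ j)
      rw [add_mul, one_mul]
      omega
    calc 64 * (#X / 2 ^ j + 1) ^ 2 * ∑ l ∈ L, #(closePairs X (2 ^ j) (gridLine X l))
        ≤ 64 * (#X / 2 ^ j + 1) ^ 2 * (#X ^ 2 * (2 ^ j) ^ 2) := Nat.mul_le_mul_left _ hpairs
      _ = 64 * ((#X / 2 ^ j + 1) * 2 ^ j) ^ 2 * #X ^ 2 := by ring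
      _ ≤ 64 * (3 * #X) ^ 2 * #X ^ 2 := by gcongr
      _ = 576 * #X ^ 4 := by ring
  · rw [card_range, smul_eq_mul, mul_comm]

/-- The ratios `(a + x) / (b + x)` with `a, b, x ∈ A`. -/
noncomputable def shiftedRatios (A : Finset ℝ) : Finset ℝ :=
  (A ×ˢ A ×ˢ A).image fun p => (p.1 + p.2.2) / (p.2.1 + p.2.2)

lemma card_shiftedRatios_collisions_le {A : Finset ℝ} (hA : A.Nonempty) (h0 : (0 : ℝ) ∉ A + A) :
    #{p ∈ (A ×ˢ A ×ˢ A) ×ˢ (A ×ˢ A ×ˢ A) | (p.1.1 + p.1.2.2) / (p.1.2.1 + p.1.2.2) =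
      (p.2.1 + p.2.2.2) / (p.2.2.1 + p.2.2.2)} ≤ 9216 * #A ^ 4 * (Nat.log 2 #A + 3) := by
  set Q := {p ∈ (A ×ˢ A ×ˢ A) ×ˢ (A ×ˢ A ×ˢ A) | (p.1.1 + p.1.2.2) / (p.1.2.1 + p.1.2.2) =
      (p.2.1 + p.2.2.2) / (p.2.2.1 + p.2.2.2)} with hQ
  have hne : ∀ a ∈ A, ∀ b ∈ A, a + b ≠ 0 := fun a ha b hb h => h0 (h ▸ add_mem_add ha hb)
  set X := A ∪ -A with hX
  have hXcard : #X ≤ 2 * #A := by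
    have h : #X ≤ #A + #(-A) := card_union_le A (-A)
    rw [card_neg] at h
    omega
  have hXne : X.Nonempty := hA.mono subset_union_left
  have hpos : ∀ a ∈ A, a ∈ X := fun a ha => mem_union_left _ ha
  have hneg : ∀ a ∈ A, -a ∈ X := fun a ha => mem_union_right _ (neg_mem_neg ha)
  set line : (ℝ × ℝ × ℝ) × (ℝ × ℝ × ℝ) → ℝ × ℝ := fun p =>
    ((p.2.2.2 + p.2.1) / (p.1.2.2 + p.1.1),
      p.2.2.2 - (p.2.2.2 + p.2.1) / (p.1.2.2 + p.1.1) * p.1.2.2) with hline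
  have hmem : ∀ p ∈ Q, (p.1.2.2, p.2.2.2) ∈ gridLine X (line p) ∧
      (-p.1.1, -p.2.1) ∈ gridLine X (line p) ∧ (-p.1.2.1, -p.2.2.1) ∈ gridLine X (line p) := by
    rintro ⟨⟨a, a', x⟩, b, b', y⟩ hp
    simp only [hQ, mem_filter, mem_product] at hp
    obtain ⟨⟨⟨ha, ha', hx⟩, hb, hb', hy⟩, heq⟩ := hp
    rw [div_eq_div_iff (hne a' ha' x hx) (hne b' hb' y hy)] at heq
    have hxa := hne x hx a ha
    simp only [gridLine, hline, mem_filter, mem_product]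
    refine ⟨⟨⟨hpos x hx, hpos y hy⟩, by ring⟩, ⟨⟨hneg a ha, hneg b hb⟩, ?_⟩,
      ⟨hneg a' ha', hneg b' hb'⟩, ?_⟩
    · field_simp
      ring
    · field_simp
      linarith
  have hL : ∀ l ∈ Q.image line, 2 ≤ #(gridLine X l) := by
    intro l hl
    obtain ⟨p, hp, rfl⟩ := mem_image.1 hl
    have hpA := hp
    simp only [hQ, mem_filter, mem_product] at hpA
    obtain ⟨⟨⟨ha, -, hx⟩, -⟩, -⟩ := hpA
    refine one_lt_card.2 ⟨_, (hmem p hp).1, _, (hmem p hp).2.1, fun h => hne _ hx _ ha ?_⟩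
    have := congrArg Prod.fst h
    dsimp only at this
    linarith
  have hlog : Nat.log 2 #X ≤ Nat.log 2 #A + 1 := by
    refine (Nat.log_mono_right hXcard).trans_eq ?_
    rw [mul_comm, Nat.log_mul_base one_lt_two hA.card_pos.ne']
  calc #Q = ∑ l ∈ Q.image line, #{p ∈ Q | line p = l} :=
        card_eq_sum_card_fiberwise fun p hp => mem_image_of_mem _ hp
    _ ≤ ∑ l ∈ Q.image line, #(gridLine X l) ^ 3 := by
        refine sum_le_sum fun l _ => ?_
        rw [show #(gridLine X l) ^ 3 = #(gridLine X l ×ˢ gridLine X l ×ˢ gridLine X l) by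
          simp only [card_product]; ring]
        refine card_le_card_of_injOn
          (fun p => ((p.1.2.2, p.2.2.2), (-p.1.1, -p.2.1), (-p.1.2.1, -p.2.2.1))) ?_ ?_
        · intro p hp
          obtain ⟨hpQ, rfl⟩ := mem_filter.1 hp
          simpa only [mem_coe, mem_product] using hmem p hpQ
        · rintro ⟨⟨a, a', x⟩, b, b', y⟩ - ⟨⟨c, c', z⟩, d, d', t⟩ - h
          simp only [Prod.mk.injEq, neg_inj] at h ⊢
          tauto
    _ ≤ 576 * #X ^ 4 * (Nat.log 2 #X + 2) := sum_card_gridLine_cube_le X hXne _ hL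
    _ ≤ 576 * (2 * #A) ^ 4 * (Nat.log 2 #A + 1 + 2) := by gcongr
    _ = 9216 * #A ^ 4 * (Nat.log 2 #A + 3) := by ring

lemma card_sq_le_card_shiftedRatios {A : Finset ℝ} (hA : 2 ≤ #A) (h0 : (0 : ℝ) ∉ A + A) :
    #A ^ 2 ≤ 36864 * Nat.log 2 #A * #(shiftedRatios A) := by
  have hcs := card_sq_le_mul_card_collisions (A ×ˢ A ×ˢ A)
    (fun p : ℝ × ℝ × ℝ => (p.1 + p.2.2) / (p.2.1 + p.2.2)) (t := shiftedRatios A)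
    fun p hp => mem_image_of_mem _ hp
  have hcoll := card_shiftedRatios_collisions_le (card_pos.1 (by omega)) h0
  have hlog : 1 ≤ Nat.log 2 #A := Nat.log_pos one_lt_two hA
  refine Nat.le_of_mul_le_mul_left ?_ (pow_pos (show 0 < #A by omega) 4)
  calc #A ^ 4 * #A ^ 2 = #(A ×ˢ A ×ˢ A) ^ 2 := by simp only [card_product]; ring
    _ ≤ #(shiftedRatios A) * (9216 * #A ^ 4 * (Nat.log 2 #A + 3)) :=
        hcs.trans (Nat.mul_le_mul_left _ hcoll)
    _ ≤ #(shiftedRatios A) * (9216 * #A ^ 4 * (4 * Nat.log 2 #A)) := by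
        gcongr
        omega
    _ = #A ^ 4 * (36864 * Nat.log 2 #A * #(shiftedRatios A)) := by ring

lemma card_shiftedRatios_sq_mul_card_le_energy {A : Finset ℝ} (hA : A.Nonempty)
    (h0 : (0 : ℝ) ∉ A + A) {B : Finset ℝ} (hB : B = (A + A) * (A + A) / ((A + A) * (A + A))) :
    #(shiftedRatios A) ^ 2 * #A ≤
      #((B ×ˢ B ×ˢ B ×ˢ B).filter fun x => x.1 + x.2.1 = x.2.2.1 + x.2.2.2) := by
  have hne : ∀ a ∈ A, ∀ b ∈ A, a + b ≠ 0 := fun a ha b hb h => h0 (h ▸ add_mem_add ha hb)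
  have hrep : ∀ r ∈ shiftedRatios A, ∃ p : ℝ × ℝ × ℝ,
      (p.1 ∈ A ∧ p.2.1 ∈ A ∧ p.2.2 ∈ A) ∧ (p.1 + p.2.2) / (p.2.1 + p.2.2) = r := by
    intro r hr
    simpa only [shiftedRatios, mem_image, mem_product] using hr
  choose! rep hrepA hrep_eq using hrep
  obtain ⟨e, he⟩ := hA
  have hee := hne e he e he
  have hBmem : ∀ r ∈ shiftedRatios A, ∀ a ∈ A, ∀ b ∈ A, r / (e + e) * (a + b) ∈ B := by
    intro r hr a ha b hb
    obtain ⟨h1, h2, h3⟩ := hrepA r hr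
    have heq : r / (e + e) * (a + b) = ((rep r).1 + (rep r).2.2) * (a + b) /
        (((rep r).2.1 + (rep r).2.2) * (e + e)) := by
      rw [mul_div_mul_comm, hrep_eq r hr]
      ring
    rw [heq, hB]
    exact div_mem_div (mul_mem_mul (add_mem_add h1 h3) (add_mem_add ha hb))
      (mul_mem_mul (add_mem_add h2 h3) (add_mem_add he he))
  have hr0 : ∀ r ∈ shiftedRatios A, r ≠ 0 := by
    intro r hr
    obtain ⟨h1, h2, h3⟩ := hrepA r hr
    rw [← hrep_eq r hr]
    exact div_ne_zero (hne _ h1 _ h3) (hne _ h2 _ h3)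
  rw [show #(shiftedRatios A) ^ 2 * #A = #(shiftedRatios A ×ˢ shiftedRatios A ×ˢ A) by
    simp only [card_product]; ring]
  refine card_le_card_of_injOn (fun q =>
    (q.2.1 / (e + e) * ((rep q.1).1 + (rep q.1).2.2),
      q.2.1 / (e + e) * ((rep q.1).2.1 + q.2.2),
      q.2.1 / (e + e) * ((rep q.1).2.1 + (rep q.1).2.2),
      q.2.1 / (e + e) * ((rep q.1).1 + q.2.2))) ?_ ?_
  · rintro ⟨r, t, z⟩ hq
    simp only [mem_coe, mem_product] at hq
    obtain ⟨hr, ht, hz⟩ := hq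
    obtain ⟨h1, h2, h3⟩ := hrepA r hr
    simp only [mem_coe, mem_filter, mem_product]
    exact ⟨⟨hBmem t ht _ h1 _ h3, hBmem t ht _ h2 _ hz, hBmem t ht _ h2 _ h3,
      hBmem t ht _ h1 _ hz⟩, by ring⟩
  · rintro ⟨r, t, z⟩ hq ⟨r', t', z'⟩ hq' h
    simp only [mem_coe, mem_product] at hq hq'
    obtain ⟨hr, ht, -⟩ := hq
    obtain ⟨hr', ht', -⟩ := hq'
    simp only [Prod.mk.injEq] at h
    obtain ⟨e1, -, e3, e4⟩ := h
    have hrr : r = r' := by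
      have := congrArg₂ (· / ·) e1 e3
      simp only [mul_div_mul_left _ _ (div_ne_zero (hr0 t ht) hee),
        mul_div_mul_left _ _ (div_ne_zero (hr0 t' ht') hee)] at this
      rwa [hrep_eq r hr, hrep_eq r' hr'] at this
    subst hrr
    obtain ⟨h1, h2, h3⟩ := hrepA r hr
    have htt : t = t' := (div_left_inj' hee).1 (mul_right_cancel₀ (hne _ h1 _ h3) e1)
    subst htt
    have hzz := mul_left_cancel₀ (div_ne_zero (hr0 t ht) hee) e4
    rw [add_left_cancel hzz]

theorem stmt_12 :
    ∃ c C : ℝ, 0 < c ∧ 0 < C ∧ ∀ A : Finset ℝ,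
      2 ≤ A.card → (0 : ℝ) ∉ A + A →
      c * (A.card : ℝ) ^ (5 : ℕ) / (Real.logb 2 (A.card : ℝ)) ^ C
        ≤ ((((((A + A) * (A + A) / ((A + A) * (A + A))) ×ˢ
              ((A + A) * (A + A) / ((A + A) * (A + A))) ×ˢ
              ((A + A) * (A + A) / ((A + A) * (A + A))) ×ˢ
              ((A + A) * (A + A) / ((A + A) * (A + A)))).filter fun x =>
            x.1 + x.2.1 = x.2.2.1 + x.2.2.2).card : ℝ)) := by
  refine ⟨1 / 36864 ^ 2, 2, by norm_num, by norm_num, fun A hA h0 => ?_⟩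
  have hE := card_shiftedRatios_sq_mul_card_le_energy (card_pos.1 (by omega)) h0 rfl
  have hR := card_sq_le_card_shiftedRatios hA h0
  have hlog : (Nat.log 2 #A : ℝ) ≤ Real.logb 2 #A := by
    have := Real.natLog_le_logb #A 2
    exact_mod_cast this
  have hlog1 : (1 : ℝ) ≤ Nat.log 2 #A := by exact_mod_cast Nat.log_pos one_lt_two hA
  refine le_trans ?_ (Nat.cast_le.2 hE)
  have hR' : (#A : ℝ) ^ 2 ≤ 36864 * Nat.log 2 #A * #(shiftedRatios A) := by exact_mod_cast hR
  rw [Real.rpow_two, div_le_iff₀ (pow_pos (by linarith) 2)]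
  push_cast
  calc 1 / 36864 ^ 2 * (#A : ℝ) ^ 5 = 1 / 36864 ^ 2 * #A * ((#A : ℝ) ^ 2) ^ 2 := by ring
    _ ≤ 1 / 36864 ^ 2 * #A * (36864 * Real.logb 2 #A * #(shiftedRatios A)) ^ 2 := by
        gcongr
        exact hR'.trans (by gcongr)
    _ = (#(shiftedRatios A) : ℝ) ^ 2 * #A * Real.logb 2 #A ^ 2 := by ring
end
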